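/- Let (W,S) be a Coxeter system. Let X_1,…,X_b be the vertex sets of the connected components of the Coxeter graph whose standard parabolic subgroups W_{X_1},…,W_{X_b} are infinite, and let Z_3 be the union of the vertex sets of the remaining (spherical) components, so that W is the internal direct product W_{X_1} × ⋯ × W_{X_b} × W_{Z_3} and W_{Z_3} is finite. Choose a Remak decomposition W_{Z_3} = H_1 × ⋯ × H_q. Then W = W_{X_1} × ⋯ × W_{X_b} × H_1 × ⋯ × H_q is a Remak decomposition of W, and for any Remak decomposition W = G_1 × ⋯ × G_m one has m = b + q and there exist a permutation σ of {1,…,m} and a central automorphism φ of W such that φ(W_{X_i}) = G_{σ(i)} for all 1 ≤ i ≤ b and φ(H_j) = G_{σ(b+j)} for all 1 ≤ j ≤ q. -/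

import Mathlib

/-!
Statement 15 (Theorem 5.2): Let (W,S) be a Coxeter system. Let X_1,…,X_b be the vertex sets of
the connected components of the Coxeter graph whose standard parabolic subgroups are infinite,
and let Z_3 be the union of the vertex sets of the remaining (spherical) components. Choose a
Remak decomposition W_{Z_3} = H_1 × ⋯ × H_q. Then W = W_{X_1} × ⋯ × W_{X_b} × H_1 × ⋯ × H_q
is a Remak decomposition of W, and for any Remak decomposition W = G_1 × ⋯ × G_m one has
m = b + q and there exist a permutation σ and a central automorphism φ of W such that
φ(W_{X_i}) = G_{σ(i)} for 1 ≤ i ≤ b and φ(H_j) = G_{σ(b+j)} for 1 ≤ j ≤ q.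
-/

noncomputable section

namespace CoxeterPaper

variable {B : Type*} {W : Type*} [Group W]

/-- The Coxeter graph of `M`: vertex set `B`, with `s, t` joined by an edge iff `m_{s,t} ≥ 3`
(where `m_{s,t} = ∞` is encoded by `M s t = 0`). -/
def coxeterGraph (M : CoxeterMatrix B) : SimpleGraph B :=
  SimpleGraph.fromRel (fun s t => M s t = 0 ∨ 3 ≤ M s t)

/-- The standard parabolic subgroup `W_X`, generated by the simple reflections indexed by `X`. -/
def standardParabolic {M : CoxeterMatrix B} (cs : CoxeterSystem M W) (X : Set B) : Subgroup W :=
  Subgroup.closure (cs.simple '' X)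

/-- A group is (directly) indecomposable if in every internal direct product decomposition
into two subgroups, one of the factors is trivial. -/
def IsIndecomposableGroup (G : Type*) [Group G] : Prop :=
  ∀ A K : Subgroup G, A.Normal → K.Normal → A ⊓ K = ⊥ →
    (∀ g : G, ∃ a ∈ A, ∃ k ∈ K, g = a * k) → A = ⊥ ∨ K = ⊥

/-- `N : ι → Subgroup G` is a Remak decomposition of the subgroup `K` of `G`: the `N i` are
non-trivial subgroups of `K`, each normalized by `K`, independent, generating `K`, and each
indecomposable as a group. -/
def IsRemakDecompositionOf {G : Type*} [Group G] {ι : Type*} (K : Subgroup G)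
    (N : ι → Subgroup G) : Prop :=
  (∀ i, N i ≠ ⊥) ∧ (∀ i, N i ≤ K) ∧
  (∀ i, ∀ g ∈ K, ∀ x ∈ N i, g * x * g⁻¹ ∈ N i) ∧
  iSupIndep N ∧ (⨆ i, N i) = K ∧ ∀ i, IsIndecomposableGroup ↥(N i)

/-- An automorphism `φ` of `G` is central if `g⁻¹ φ(g) ∈ Z(G)` for all `g`. -/
def IsCentralAut {G : Type*} [Group G] (φ : G ≃* G) : Prop :=
  ∀ g : G, g⁻¹ * φ g ∈ Subgroup.center G

/-- An endomorphism is normal if it commutes with all inner automorphisms. -/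
def IsNormalEnd {A : Type*} [Group A] (f : A →* A) : Prop :=
  ∀ g x, f (g * x * g⁻¹) = g * f x * g⁻¹

section NormalEnd

variable {A : Type*} [Group A] {f : A →* A}

theorem IsNormalEnd.map_mem_center (hf : IsNormalEnd f) {z : A} (hz : z ∈ Subgroup.center A) :
    f z ∈ Subgroup.center A := by
  rw [Subgroup.mem_center_iff] at hz ⊢
  intro g
  have h := hf g z
  rw [hz g, mul_inv_cancel_right] at h
  rw [eq_mul_inv_iff_mul_eq] at h
  exact h.symm

theorem IsNormalEnd.map_conj_eq (hf : IsNormalEnd f) (g x : A) :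
    f g * f x * (f g)⁻¹ = g * f x * g⁻¹ := by
  rw [← hf g x]; simp

/-- The image of a normal endomorphism is moved by it only within the centre. -/
theorem IsNormalEnd.inv_mul_map_mem_center (hf : IsNormalEnd f) (x : A) :
    (f x)⁻¹ * f (f x) ∈ Subgroup.center A := by
  rw [Subgroup.mem_center_iff]
  intro w
  have hc : ∀ y, (x⁻¹ * f x) * f y * (x⁻¹ * f x)⁻¹ = f y := by
    intro y
    have h := hf.map_conj_eq x y
    calc (x⁻¹ * f x) * f y * (x⁻¹ * f x)⁻¹ = x⁻¹ * (f x * f y * (f x)⁻¹) * x := by group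
      _ = f y := by rw [h]; group
  have hw := hf.map_conj_eq w (x⁻¹ * f x)
  have hw' := hf.map_conj_eq (f w) (x⁻¹ * f x)
  have h1 := congrArg f (hc w)
  have h2 : f (x⁻¹ * f x) = (f x)⁻¹ * f (f x) := by simp
  rw [h2] at hw hw'
  have h3 := congrArg f (hc (w))
  simp only [map_mul, map_inv] at h3
  rw [hw] at hw'
  have h4 : ((f x)⁻¹ * f (f x)) * f (f w) = f (f w) * ((f x)⁻¹ * f (f x)) := by
    rw [mul_inv_eq_iff_eq_mul] at h3
    simpa [mul_assoc] using h3
  rw [mul_assoc, ← mul_assoc, ← h4] at hw'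
  rw [← hw] at hw'
  have h5 : w * ((f x)⁻¹ * f (f x)) * w⁻¹ = (f x)⁻¹ * f (f x) := by
    rw [← hw, ← hw']; group
  exact mul_inv_eq_iff_eq_mul.1 h5

/-- A normal endomorphism of a group with finite centre has an idempotent positive power. -/
theorem IsNormalEnd.exists_iterate_idempotent [Finite (Subgroup.center A)] (hf : IsNormalEnd f) :
    ∃ k, 0 < k ∧ ∀ x, f^[k] (f^[k] x) = f^[k] x := by
  let Z := Subgroup.center A
  let D : ℕ → Z → Z := fun n z => Nat.rec 1
    (fun _ d => z * ⟨f d, hf.map_mem_center d.2⟩) n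
  have hD : ∀ n x, f^[n + 1] x = f x * (D n ⟨_, hf.inv_mul_map_mem_center x⟩).1 := by
    intro n x
    induction n with
    | zero => simp [D]
    | succ n ih =>
      rw [Function.iterate_succ_apply', ih]
      simp only [D, Subgroup.coe_mul, map_mul]
      group
  obtain ⟨a, d, hd, had⟩ : ∃ a d, 0 < d ∧ f^[a + d] = f^[a] := by
    obtain ⟨m, n, hmn, h⟩ := Finite.exists_ne_map_eq_of_infinite D
    wlog hlt : m < n generalizing m n
    · exact this n m hmn.symm h.symm (by omega)
    refine ⟨m + 1, n - m, by omega, ?_⟩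
    funext x
    rw [show m + 1 + (n - m) = n + 1 by omega, hD, hD, h]
  have hper : ∀ j i, a ≤ i → f^[i + j * d] = f^[i] := by
    intro j i hi
    induction j with
    | zero => simp
    | succ j ih =>
      obtain ⟨r, rfl⟩ := Nat.exists_eq_add_of_le hi
      rw [show a + r + (j + 1) * d = (r + j * d) + (a + d) by ring, Function.iterate_add, had,
        ← Function.iterate_add, show r + j * d + a = a + r + j * d by ring, ih]
  refine ⟨(a + 1) * d, by positivity, fun x => ?_⟩
  rw [← Function.iterate_add_apply, hper]
  nlinarith

theorem IsNormalEnd.comp {g : A →* A} (hf : IsNormalEnd f) (hg : IsNormalEnd g) :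
    IsNormalEnd (f.comp g) := fun a x => by
  simp only [MonoidHom.comp_apply]; rw [hg, hf]

/-- Fitting's lemma for normal endomorphisms of an indecomposable group with finite centre. -/
theorem IsNormalEnd.bijective_or_nilpotent [Finite (Subgroup.center A)]
    (hA : IsIndecomposableGroup A) (hf : IsNormalEnd f) :
    Function.Bijective f ∨ ∃ n, ∀ x, f^[n] x = 1 := by
  obtain ⟨k, hk, hidem⟩ := hf.exists_iterate_idempotent
  obtain ⟨p, hp⟩ : ∃ p : A →* A, ⇑p = f^[k] :=
    let e : Monoid.End A := f
    ⟨e ^ k, Monoid.End.coe_pow _ e k⟩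
  have hpn : IsNormalEnd p := by
    intro g x
    rw [hp]
    clear hp hidem hk
    induction k with
    | zero => rfl
    | succ k ih => rw [Function.iterate_succ_apply', Function.iterate_succ_apply', ih, hf]
  rw [← hp] at hidem
  have hrange : p.range.Normal := by
    constructor
    rintro _ ⟨x, rfl⟩ g
    exact ⟨g * x * g⁻¹, hpn g x⟩
  have hdisj : p.ker ⊓ p.range = ⊥ := by
    rw [eq_bot_iff]
    rintro _ ⟨h1, x, rfl⟩
    have h2 : p (p x) = 1 := h1
    rwa [hidem] at h2
  have hdec : ∀ g : A, ∃ a ∈ p.ker, ∃ c ∈ p.range, g = a * c := by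
    intro g
    refine ⟨g * (p g)⁻¹, ?_, p g, ⟨g, rfl⟩, by simp⟩
    rw [MonoidHom.mem_ker, map_mul, map_inv, hidem, mul_inv_cancel]
  rcases hA p.ker p.range inferInstance hrange hdisj hdec with h | h
  · left
    have hinj : Function.Injective p := (MonoidHom.ker_eq_bot_iff p).1 h
    have hid : ∀ x, f^[k] x = x := fun x => by
      rw [← hp]; exact hinj (hidem x)
    obtain ⟨k, rfl⟩ := Nat.exists_eq_succ_of_ne_zero hk.ne'
    refine ⟨fun x y hxy => ?_, fun y => ⟨f^[k] y, ?_⟩⟩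
    · rw [← hid x, ← hid y, Function.iterate_succ_apply, Function.iterate_succ_apply, hxy]
    · rw [← Function.iterate_succ_apply' f]; exact hid y
  · right
    refine ⟨k, fun x => ?_⟩
    rw [← hp, ← Subgroup.mem_bot, ← h]
    exact ⟨x, rfl⟩

theorem IsNormalEnd.bijective_or_bijective [Finite (Subgroup.center A)] [Nontrivial A]
    (hA : IsIndecomposableGroup A) {g : A →* A} (hf : IsNormalEnd f) (hg : IsNormalEnd g)
    (hfg : ∀ x, f x * g x = x) : Function.Bijective f ∨ Function.Bijective g := by
  rcases hf.bijective_or_nilpotent hA with h | ⟨n, hn⟩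
  · exact Or.inl h
  rcases hg.bijective_or_nilpotent hA with h | ⟨m, hm⟩
  · exact Or.inr h
  exfalso
  have hker : ∃ x, x ≠ 1 ∧ f x = 1 := by
    by_contra! hcon
    obtain ⟨x, hx⟩ := exists_ne (1 : A)
    have : ∀ k, f^[k] x ≠ 1 := by
      intro k
      induction k with
      | zero => exact hx
      | succ k ih =>
        rw [Function.iterate_succ_apply']
        exact hcon _ ih
    exact this n (hn x)
  obtain ⟨x, hx, hfx⟩ := hker
  have hgx : g x = x := by have := hfg x; rwa [hfx, one_mul] at this
  exact hx (by rw [← Function.iterate_fixed hgx m, hm])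

/-- If an additive family of normal endomorphisms of an indecomposable group has a bijective
member, then one of the summands is bijective. -/
theorem exists_bijective_of_bijective_finset [Finite (Subgroup.center A)] [Nontrivial A]
    (hA : IsIndecomposableGroup A) {κ : Type*} [DecidableEq κ] (F : Finset κ → A →* A)
    (hF : ∀ I, IsNormalEnd (F I)) (hempty : ∀ x, F ∅ x = 1)
    (hins : ∀ i I x, i ∉ I → F (insert i I) x = F {i} x * F I x)
    (I : Finset κ) (hI : Function.Bijective (F I)) :
    ∃ i ∈ I, Function.Bijective (F {i}) := by
  induction I using Finset.induction_on with
  | empty =>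
    obtain ⟨x, hx⟩ := exists_ne (1 : A)
    exact absurd (hI.1 ((hempty x).trans (hempty 1).symm)) hx
  | insert i I hi ih =>
    let e : A ≃* A := MulEquiv.ofBijective (F (insert i I)) hI
    have he : IsNormalEnd e.symm.toMonoidHom := by
      intro g x
      apply e.injective
      have := hF (insert i I) g (e.symm x)
      change e (g * e.symm x * g⁻¹) = g * e (e.symm x) * g⁻¹ at this
      rw [e.apply_symm_apply] at this
      change e (e.symm _) = e (g * e.symm x * g⁻¹)
      rw [this, e.apply_symm_apply]
    have key := (he.comp (hF {i})).bijective_or_bijective hA (he.comp (hF I)) (fun x => by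
      apply e.injective
      change e (e.symm (F {i} x) * e.symm (F I x)) = F (insert i I) x
      rw [map_mul, e.apply_symm_apply, e.apply_symm_apply, hins i I x hi])
    have hcancel : ∀ g : A →* A, Function.Bijective (e.symm.toMonoidHom.comp g) →
        Function.Bijective g := by
      intro g hg
      have : ⇑g = e ∘ (e.symm.toMonoidHom.comp g) := by
        funext x; simp
      rw [this]
      exact e.bijective.comp hg
    rcases key with h | h
    · exact ⟨i, Finset.mem_insert_self _ _, hcancel _ h⟩
    · obtain ⟨j, hj, hb⟩ := ih (hcancel _ h)
      exact ⟨j, Finset.mem_insert_of_mem hj, hb⟩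

end NormalEnd

section InternalProduct

variable {G : Type*} [Group G]

/-- Projection onto the first factor of an internal direct product of two subgroups. -/
theorem exists_projection_of_isCompl {P Q : Subgroup G} (hP : P.Normal) (hQ : Q.Normal)
    (h : IsCompl P Q) :
    ∃ π : G →* G, (∀ x ∈ P, π x = x) ∧ (∀ x ∈ Q, π x = 1) ∧ (∀ x, π x ∈ P) ∧
      ∀ x, (π x)⁻¹ * x ∈ Q := by
  have hex : ∀ x : G, ∃ a ∈ P, ∃ c ∈ Q, a * c = x := fun x => by
    have hx : x ∈ P ⊔ Q := by rw [h.sup_eq_top]; trivial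
    exact Subgroup.mem_sup_of_normal_right.1 hx
  have huniq : ∀ a ∈ P, ∀ c ∈ Q, ∀ a' ∈ P, ∀ c' ∈ Q, a * c = a' * c' → a = a' := by
    intro a ha c hc a' ha' c' hc' heq
    have h1 : a'⁻¹ * a = c' * c⁻¹ := by
      rw [inv_mul_eq_iff_eq_mul, ← mul_assoc, eq_mul_inv_iff_mul_eq, heq]
    have h2 : a'⁻¹ * a ∈ P ⊓ Q :=
      ⟨P.mul_mem (P.inv_mem ha') ha, by
        rw [SetLike.mem_coe, h1]; exact Q.mul_mem hc' (Q.inv_mem hc)⟩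
    rw [h.inf_eq_bot, Subgroup.mem_bot, inv_mul_eq_one] at h2
    exact h2.symm
  choose p hp q hq hpq using hex
  have hcomm : ∀ a ∈ P, ∀ c ∈ Q, a * c = c * a := fun a ha c hc =>
    Subgroup.commute_of_normal_of_disjoint P Q hP hQ h.disjoint a c ha hc
  refine ⟨MonoidHom.mk' p fun x y => ?_, fun x hx => ?_, fun x hx => ?_, hp, fun x => ?_⟩
  · refine huniq _ (hp _) (q (x * y)) (hq _) _ (P.mul_mem (hp x) (hp y)) (q x * q y)
      (Q.mul_mem (hq x) (hq y)) ?_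
    have h1 := hcomm _ (hp y) _ (hq x)
    calc p (x * y) * q (x * y) = (p x * q x) * (p y * q y) := by rw [hpq, hpq, hpq]
      _ = p x * (q x * p y) * q y := by group
      _ = _ := by rw [← h1]; group
  · exact huniq _ (hp _) _ (hq _) x hx 1 Q.one_mem (by rw [hpq, mul_one])
  · exact huniq _ (hp _) _ (hq _) 1 P.one_mem x hx (by rw [hpq, one_mul])
  · have : (p x)⁻¹ * x = q x := by rw [inv_mul_eq_iff_eq_mul, hpq]
    change (p x)⁻¹ * x ∈ Q
    rw [this]
    exact hq x

theorem IsRemakDecompositionOf.normal {ι : Type*} {N : ι → Subgroup G}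
    (hN : IsRemakDecompositionOf ⊤ N) (i : ι) : (N i).Normal :=
  ⟨fun x hx g => hN.2.2.1 i g trivial x hx⟩

theorem pairwise_commute_of_iSupIndep {ι : Type*} {N : ι → Subgroup G}
    (hnorm : ∀ i, (N i).Normal) (hind : iSupIndep N) :
    Pairwise fun i j => ∀ x y : G, x ∈ N i → y ∈ N j → Commute x y := fun i j hij =>
  Subgroup.commute_of_normal_of_disjoint _ _ (hnorm i) (hnorm j) (hind.pairwiseDisjoint hij)

/-- An internal direct product is isomorphic to the direct product of its factors. -/
theorem exists_mulEquiv_pi {ι : Type*} [Fintype ι] [DecidableEq ι] {N : ι → Subgroup G}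
    (hnorm : ∀ i, (N i).Normal) (hind : iSupIndep N) (hsup : ⨆ i, N i = ⊤) :
    ∃ Φ : (∀ i, N i) ≃* G, ∀ i (x : N i), Φ (Pi.mulSingle i x) = x := by
  have hcomm := pairwise_commute_of_iSupIndep hnorm hind
  refine ⟨MulEquiv.ofBijective (Subgroup.noncommPiCoprod hcomm)
    ⟨Subgroup.injective_noncommPiCoprod_of_iSupIndep hind, ?_⟩, fun i x => ?_⟩
  · rw [← MonoidHom.range_eq_top, Subgroup.noncommPiCoprod_range, hsup]
  · exact Subgroup.noncommPiCoprod_mulSingle (hcomm := hcomm) i x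

theorem finite_center_of_iSupIndep {ι : Type*} [Fintype ι] {N : ι → Subgroup G}
    (hnorm : ∀ i, (N i).Normal) (hind : iSupIndep N) (hsup : ⨆ i, N i = ⊤)
    (hfin : ∀ i, Finite (Subgroup.center (N i))) : Finite (Subgroup.center G) := by
  classical
  obtain ⟨Φ, -⟩ := exists_mulEquiv_pi hnorm hind hsup
  have hmem : ∀ z : Subgroup.center G, ∀ i, Φ.symm z i ∈ Subgroup.center (N i) := by
    intro z i
    rw [Subgroup.mem_center_iff]
    intro g
    have h := Subgroup.mem_center_iff.1 z.2 (Φ (Pi.mulSingle i g))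
    have h' := congrFun (congrArg Φ.symm h) i
    simpa using h'
  refine Finite.of_injective
    (fun z i => (⟨Φ.symm z i, hmem z i⟩ : Subgroup.center (N i))) fun z w hzw => ?_
  apply Subtype.ext
  apply Φ.symm.injective
  funext i
  exact congrArg Subtype.val (congrFun hzw i)

theorem IsRemakDecompositionOf.isCompl {ι : Type*} {N : ι → Subgroup G}
    (hN : IsRemakDecompositionOf ⊤ N) (i : ι) : IsCompl (N i) (⨆ j, ⨆ _ : j ≠ i, N j) := by
  refine ⟨hN.2.2.2.1 i, codisjoint_iff.2 ?_⟩
  rw [eq_top_iff, ← hN.2.2.2.2.1, iSup_le_iff]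
  intro j
  by_cases hj : j = i
  · subst hj; exact le_sup_left
  · exact le_sup_of_le_right (le_iSup₂_of_le j hj le_rfl)

theorem IsIndecomposableGroup.of_mulEquiv {G' : Type*} [Group G'] (h : IsIndecomposableGroup G)
    (e : G ≃* G') : IsIndecomposableGroup G' := by
  intro P Q hP hQ hPQ hdec
  have hbot : ∀ R : Subgroup G', R.comap e.toMonoidHom = ⊥ → R = ⊥ := by
    intro R hR
    rw [eq_bot_iff]
    intro x hx
    have h1 : e.symm x ∈ R.comap e.toMonoidHom := by
      change e (e.symm x) ∈ R
      rwa [e.apply_symm_apply]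
    rw [hR, Subgroup.mem_bot] at h1
    rw [Subgroup.mem_bot, ← e.apply_symm_apply x, h1, map_one]
  refine (h (P.comap e.toMonoidHom) (Q.comap e.toMonoidHom) inferInstance inferInstance ?_ ?_).imp
    (hbot P) (hbot Q)
  · rw [← Subgroup.comap_inf, hPQ]
    exact (MonoidHom.ker_eq_bot_iff e.toMonoidHom).2 e.injective
  · intro g
    obtain ⟨a, ha, c, hc, hac⟩ := hdec (e g)
    refine ⟨e.symm a, ?_, e.symm c, ?_, ?_⟩
    · change e (e.symm a) ∈ P
      rwa [e.apply_symm_apply]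
    · change e (e.symm c) ∈ Q
      rwa [e.apply_symm_apply]
    · rw [← map_mul, ← hac, e.symm_apply_apply]

theorem IsRemakDecompositionOf.map {ι : Type*} {N : ι → Subgroup G}
    (hN : IsRemakDecompositionOf ⊤ N) (φ : G ≃* G) :
    IsRemakDecompositionOf ⊤ (fun i => (N i).map φ.toMonoidHom) := by
  have hinj : Function.Injective φ.toMonoidHom := φ.injective
  refine ⟨fun i h => hN.1 i ((Subgroup.map_eq_bot_iff_of_injective _ hinj).1 h), fun i => le_top,
    fun i g _ x hx => ?_, fun i => ?_, ?_, fun i => ?_⟩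
  · exact ((hN.normal i).map φ.toMonoidHom φ.surjective).conj_mem x hx g
  · simp only [← Subgroup.map_iSup]
    exact Subgroup.disjoint_map hinj (hN.2.2.2.1 i)
  · rw [← Subgroup.map_iSup, hN.2.2.2.2.1]
    exact Subgroup.map_top_of_surjective _ φ.surjective
  · exact (hN.2.2.2.2.2 i).of_mulEquiv ((N i).equivMapOfInjective _ hinj)

/-- Exchange property: an indecomposable direct factor can be moved by a central automorphism that
fixes a complement pointwise to a member of any given Remak decomposition. -/
theorem exists_centralAut_map_eq [Finite (Subgroup.center G)] {κ : Type*} [Fintype κ]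
    {N : κ → Subgroup G} (hN : IsRemakDecompositionOf ⊤ N)
    {P Q : Subgroup G} (hP : P.Normal) (hQ : Q.Normal) (hPQ : IsCompl P Q) (hPbot : P ≠ ⊥)
    (hPind : IsIndecomposableGroup P) :
    ∃ (j : κ) (φ : G ≃* G), IsCentralAut φ ∧ P.map φ.toMonoidHom = N j ∧ ∀ x ∈ Q, φ x = x := by
  classical
  obtain ⟨π, hπP, hπQ, hπmem, hπinv⟩ := exists_projection_of_isCompl hP hQ hPQ
  obtain ⟨Φ, hΦ⟩ := exists_mulEquiv_pi hN.normal hN.2.2.2.1 hN.2.2.2.2.1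
  have hcomm : ∀ a ∈ P, ∀ c ∈ Q, a * c = c * a := fun a ha c hc =>
    Subgroup.commute_of_normal_of_disjoint P Q hP hQ hPQ.disjoint a c ha hc
  have hπn : IsNormalEnd π := by
    intro g x
    have h1 : g = π g * ((π g)⁻¹ * g) := by group
    have h2 := hcomm _ (hπmem x) _ (hπinv g)
    calc π (g * x * g⁻¹) = π g * π x * (π g)⁻¹ := by simp
      _ = π g * (π x * ((π g)⁻¹ * g)) * g⁻¹ := by group
      _ = g * π x * g⁻¹ := by rw [h2]; group
  let mask : Finset κ → (∀ i, N i) →* (∀ i, N i) := fun I =>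
    MonoidHom.pi fun i => if i ∈ I then Pi.evalMonoidHom _ i else 1
  have hmask : ∀ I x i, mask I x i = if i ∈ I then x i else 1 := by
    intro I x i
    simp only [mask, MonoidHom.pi_apply]
    split_ifs <;> rfl
  let ρ : Finset κ → G →* G := fun I => Φ.toMonoidHom.comp ((mask I).comp Φ.symm.toMonoidHom)
  have hρ : ∀ I x i, Φ.symm (ρ I x) i = if i ∈ I then Φ.symm x i else 1 := by
    intro I x i
    rw [← hmask]
    simp [ρ]
  have hext : ∀ x y : G, (∀ i, Φ.symm x i = Φ.symm y i) → x = y := fun x y h =>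
    Φ.symm.injective (funext h)
  have hρn : ∀ I, IsNormalEnd (ρ I) := by
    intro I g x
    apply hext
    intro i
    simp only [map_mul, map_inv, Pi.mul_apply, Pi.inv_apply, hρ]
    split_ifs <;> simp
  let F : Finset κ → P →* P := fun I =>
    ((π.comp (ρ I)).comp P.subtype).codRestrict P fun x => hπmem _
  have hFc : ∀ I x, (F I x : G) = π (ρ I x) := fun I x => rfl
  have hFn : ∀ I, IsNormalEnd (F I) := fun I g x => Subtype.ext (hπn.comp (hρn I) g x)
  have : Finite (Subgroup.center P) := by
    refine Finite.of_injective (fun z => (⟨z.1.1, ?_⟩ : Subgroup.center G)) ?_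
    · rw [Subgroup.mem_center_iff]
      intro g
      have h1 := congrArg Subtype.val (Subgroup.mem_center_iff.1 z.2 ⟨π g, hπmem g⟩)
      have h2 := hcomm _ z.1.2 _ (hπinv g)
      change π g * z.1.1 = z.1.1 * π g at h1
      calc g * z.1.1 = π g * (((π g)⁻¹ * g) * z.1.1) := by group
        _ = z.1.1 * g := by rw [← h2, ← mul_assoc, h1]; group
    · intro z w h
      exact Subtype.ext (Subtype.ext (Subtype.mk.inj h))
  have : Nontrivial P := (Subgroup.nontrivial_iff_ne_bot P).2 hPbot
  obtain ⟨j, -, hj⟩ := exists_bijective_of_bijective_finset hPind F hFn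
    (fun x => by
      apply Subtype.ext
      have : ρ ∅ x = 1 := hext _ _ fun i => by rw [hρ]; simp
      rw [hFc, this, map_one]; rfl)
    (fun i I x hi => by
      apply Subtype.ext
      rw [Subgroup.coe_mul, hFc, hFc, hFc, ← map_mul]
      congr 1
      apply hext
      intro k
      rw [map_mul, Pi.mul_apply, hρ, hρ, hρ]
      by_cases hk : k = i
      · subst hk; simp [hi]
      · simp [hk])
    Finset.univ
    (by
      have : F Finset.univ = MonoidHom.id P := by
        ext x
        have h1 : ρ Finset.univ x = x := hext _ _ fun i => by rw [hρ]; simp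
        rw [hFc, h1, hπP _ x.2]; rfl
      rw [this]
      exact Function.bijective_id)
  have hNj : ∀ y ∈ N j, ∀ i, i ≠ j → Φ.symm y i = 1 := by
    intro y hy i hi
    have : Φ (Pi.mulSingle j ⟨y, hy⟩) = y := hΦ j ⟨y, hy⟩
    rw [← this, Φ.symm_apply_apply]
    exact Pi.mulSingle_eq_of_ne hi _
  have hρmem : ∀ x, ρ {j} x ∈ N j := by
    intro x
    have : ρ {j} x = Φ (Pi.mulSingle j (Φ.symm x j)) := by
      apply hext
      intro i
      rw [hρ, Φ.symm_apply_apply]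
      by_cases hi : i = j
      · subst hi; simp
      · simp [hi]
    rw [this, hΦ]
    exact (Φ.symm x j).2
  have hinj : ∀ a ∈ P, π (ρ {j} a) = 1 → a = 1 := by
    intro a ha h
    have : (⟨a, ha⟩ : P) = 1 := hj.1 (by rw [map_one]; exact Subtype.ext h)
    exact congrArg Subtype.val this
  have hsurj : ∀ y, ∃ a ∈ P, π (ρ {j} a) = π y := by
    intro y
    obtain ⟨a, ha⟩ := hj.2 ⟨π y, hπmem y⟩
    exact ⟨a, a.2, congrArg Subtype.val ha⟩
  have hker : ∀ x, π x = 1 → x ∈ Q := by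
    intro x hx
    simpa [hx] using hπinv x
  have hmapN : (P.map (ρ {j})).Normal := by
    constructor
    rintro _ ⟨x, hx, rfl⟩ g
    exact ⟨g * x * g⁻¹, hP.conj_mem x hx g, hρn _ g x⟩
  have hdec : ∀ y : N j, ∃ a ∈ (P.map (ρ {j})).subgroupOf (N j),
      ∃ c ∈ Q.subgroupOf (N j), y = a * c := by
    intro y
    obtain ⟨a, ha, hay⟩ := hsurj y
    refine ⟨⟨ρ {j} a, hρmem a⟩, ⟨a, ha, rfl⟩, ⟨(ρ {j} a)⁻¹ * y,
      (N j).mul_mem ((N j).inv_mem (hρmem a)) y.2⟩, ?_, ?_⟩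
    · rw [Subgroup.mem_subgroupOf]
      apply hker
      rw [map_mul, map_inv, hay, inv_mul_cancel]
    · apply Subtype.ext
      simp
  have hQbot : Q.subgroupOf (N j) = ⊥ := by
    have hdisj : (P.map (ρ {j})).subgroupOf (N j) ⊓ Q.subgroupOf (N j) = ⊥ := by
      rw [eq_bot_iff]
      rintro y ⟨⟨a, ha, hay⟩, hyQ⟩
      have h1 : π (y : G) = 1 := hπQ _ hyQ
      change ρ {j} a = (y : G) at hay
      rw [← hay] at h1
      rw [hinj a ha h1, map_one] at hay
      exact Subtype.ext hay.symm
    rcases hN.2.2.2.2.2 j ((P.map (ρ {j})).subgroupOf (N j)) (Q.subgroupOf (N j))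
      inferInstance inferInstance hdisj hdec with h | h
    · exfalso
      apply hPbot
      rw [eq_bot_iff]
      intro a ha
      have h1 : (⟨ρ {j} a, hρmem a⟩ : N j) ∈ (P.map (ρ {j})).subgroupOf (N j) := ⟨a, ha, rfl⟩
      rw [h, Subgroup.mem_bot] at h1
      have h2 : ρ {j} a = 1 := congrArg Subtype.val h1
      exact hinj a ha (by rw [h2, map_one])
    · exact h
  have hmapEq : P.map (ρ {j}) = N j := by
    apply le_antisymm
    · rintro _ ⟨x, -, rfl⟩
      exact hρmem x
    · intro y hy
      obtain ⟨a, ha, c, hc, hac⟩ := hdec ⟨y, hy⟩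
      rw [hQbot, Subgroup.mem_bot] at hc
      rw [hc, mul_one] at hac
      rw [← hac] at ha
      exact ha
  have hζ : ∀ a ∈ P, ρ {j} a * a⁻¹ ∈ Subgroup.center G := by
    intro a ha
    rw [Subgroup.mem_center_iff]
    have h1 : ∀ y ∈ N j, y * (ρ {j} a * a⁻¹) = (ρ {j} a * a⁻¹) * y := by
      intro y hy
      apply hext
      intro i
      simp only [map_mul, map_inv, Pi.mul_apply, Pi.inv_apply, hρ]
      by_cases hi : i = j
      · simp [hi]
      · simp [hNj y hy i hi]
    have h2 : ∀ c ∈ Q, c * (ρ {j} a * a⁻¹) = (ρ {j} a * a⁻¹) * c := by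
      intro c hc
      apply hext
      intro i
      have h3 := congrFun (congrArg Φ.symm (hcomm _ (P.inv_mem ha) c hc)) i
      simp only [map_mul, map_inv, Pi.mul_apply, Pi.inv_apply, hρ] at h3 ⊢
      by_cases hi : i = j
      · simp [hi]
      · simp [hi, h3]
    intro g
    obtain ⟨a', ha', hag⟩ := hsurj g
    have hg : g = ρ {j} a' * ((ρ {j} a')⁻¹ * g) := by group
    have hc : (ρ {j} a')⁻¹ * g ∈ Q := hker _ (by rw [map_mul, map_inv, hag, inv_mul_cancel])
    rw [hg, mul_assoc, h2 _ hc, ← mul_assoc, h1 _ (hρmem a'), mul_assoc]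
  let φ : G →* G := MonoidHom.mk' (fun x => (ρ {j} (π x) * (π x)⁻¹) * x) fun x y => by
    have h1 := Subgroup.mem_center_iff.1 (hζ (π y) (hπmem y)) 
    simp only [map_mul, mul_inv_rev]
    calc ρ {j} (π x) * ρ {j} (π y) * ((π y)⁻¹ * (π x)⁻¹) * (x * y)
        = ρ {j} (π x) * ((ρ {j} (π y) * (π y)⁻¹) * ((π x)⁻¹ * x)) * y := by group
      _ = _ := by rw [← h1]; group
  have hφ : ∀ x, φ x = (ρ {j} (π x) * (π x)⁻¹) * x := fun x => rfl
  have hφP : ∀ x ∈ P, φ x = ρ {j} x := by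
    intro x hx
    rw [hφ, hπP x hx]; group
  have hφQ : ∀ x ∈ Q, φ x = x := by
    intro x hx
    rw [hφ, hπQ x hx]; simp
  have hπφ : ∀ x, π (φ x) = π (ρ {j} (π x)) := by
    intro x
    rw [hφ, map_mul, map_mul, map_inv, hπP _ (hπmem x)]; group
  have hφb : Function.Bijective φ := by
    constructor
    · rw [injective_iff_map_eq_one]
      intro x hx
      have h1 := hπφ x
      rw [hx, map_one] at h1
      have h2 := hinj _ (hπmem x) h1.symm
      rwa [hφ, h2, map_one, inv_one, one_mul, one_mul] at hx
    · intro y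
      obtain ⟨a, ha, hay⟩ := hsurj y
      have hc : (ρ {j} a)⁻¹ * y ∈ Q := hker _ (by rw [map_mul, map_inv, hay, inv_mul_cancel])
      exact ⟨a * ((ρ {j} a)⁻¹ * y), by rw [map_mul, hφP a ha, hφQ _ hc]; group⟩
  refine ⟨j, MulEquiv.ofBijective φ hφb, fun g => ?_, ?_, hφQ⟩
  · change g⁻¹ * φ g ∈ _
    rw [hφ, ← Subgroup.mem_center_iff.1 (hζ (π g) (hπmem g)), inv_mul_cancel_left]
    exact hζ _ (hπmem g)
  · rw [← hmapEq]
    ext y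
    constructor
    · rintro ⟨x, hx, rfl⟩
      exact ⟨x, hx, (hφP x hx).symm⟩
    · rintro ⟨x, hx, rfl⟩
      exact ⟨x, hx, hφP x hx⟩

theorem IsCentralAut.trans {φ ψ : G ≃* G} (hφ : IsCentralAut φ) (hψ : IsCentralAut ψ) :
    IsCentralAut (φ.trans ψ) := fun g => by
  have h := mul_mem (hφ g) (hψ (φ g))
  rwa [mul_assoc, mul_inv_cancel_left] at h

/-- **Krull–Remak–Schmidt** for groups with finite centre. -/
theorem IsRemakDecompositionOf.exists_equiv_centralAut [Finite (Subgroup.center G)]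
    {ι κ : Type*} [Fintype ι] [Fintype κ] {N : ι → Subgroup G} {K : κ → Subgroup G}
    (hN : IsRemakDecompositionOf ⊤ N) (hK : IsRemakDecompositionOf ⊤ K) :
    ∃ (σ : ι ≃ κ) (φ : G ≃* G), IsCentralAut φ ∧ ∀ i, (N i).map φ.toMonoidHom = K (σ i) := by
  classical
  have key : ∀ s : Finset ι, ∃ φ : G ≃* G, IsCentralAut φ ∧
      ∀ i ∈ s, ∃ j, (N i).map φ.toMonoidHom = K j := by
    intro s
    induction s using Finset.induction_on with
    | empty => exact ⟨MulEquiv.refl G, fun g => by simp, by simp⟩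
    | insert a s ha ih =>
      obtain ⟨φ, hφ, hs⟩ := ih
      have hN' := hN.map φ
      obtain ⟨j, ψ, hψ, hj, hfix⟩ := exists_centralAut_map_eq hK (hN'.normal a)
        (Subgroup.biSup_normal {j | j ≠ a} _ fun i _ => hN'.normal i)
        (hN'.isCompl a) (hN'.1 a) (hN'.2.2.2.2.2 a)
      have hcomp : ∀ i, (N i).map (φ.trans ψ).toMonoidHom =
          ((N i).map φ.toMonoidHom).map ψ.toMonoidHom := fun i => by
        rw [Subgroup.map_map]; rfl
      refine ⟨φ.trans ψ, hφ.trans hψ, fun i hi => ?_⟩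
      rw [hcomp]
      rcases Finset.mem_insert.1 hi with rfl | hi
      · exact ⟨j, hj⟩
      · obtain ⟨k, hk⟩ := hs i hi
        refine ⟨k, ?_⟩
        rw [← hk]
        have hia : i ≠ a := fun h => ha (h ▸ hi)
        have hle : (N i).map φ.toMonoidHom ≤ ⨆ j, ⨆ _ : j ≠ a, (N j).map φ.toMonoidHom :=
          le_iSup₂_of_le i hia le_rfl
        ext y
        constructor
        · rintro ⟨x, hx, rfl⟩
          change ψ x ∈ _
          rw [hfix x (hle hx)]
          exact hx
        · intro hy
          exact ⟨y, hy, hfix y (hle hy)⟩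
  obtain ⟨φ, hφ, h⟩ := key Finset.univ
  choose σ hσ using fun i => h i (Finset.mem_univ i)
  have hN' := hN.map φ
  have hinj : Function.Injective σ := by
    intro i i' hii
    by_contra hne
    have h1 := hN'.2.2.2.1.pairwiseDisjoint hne
    rw [Function.onFun, hσ, hσ, hii, disjoint_self] at h1
    exact hK.1 _ h1
  have hsurj : Function.Surjective σ := by
    intro j
    by_contra hne
    push Not at hne
    apply hK.1 j
    rw [← disjoint_self]
    refine (hK.2.2.2.1 j).mono_right ?_
    calc K j ≤ ⊤ := le_top
      _ = ⨆ i, (N i).map φ.toMonoidHom := hN'.2.2.2.2.1.symm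
      _ ≤ _ := iSup_le fun i => by
        rw [hσ]
        exact le_iSup₂_of_le (σ i) (hne i) le_rfl
  exact ⟨Equiv.ofBijective σ ⟨hinj, hsurj⟩, φ, hφ, hσ⟩

end InternalProduct

section DihedralPlane

/-- The rescaled Chebyshev sequence `sin (n θ) / sin θ`, as a function of `c = cos θ`. -/
def sineRatio (c : ℝ) : ℕ → ℝ
  | 0 => 0
  | 1 => 1
  | n + 2 => 2 * c * sineRatio c (n + 1) - sineRatio c n

theorem sineRatio_one (n : ℕ) : sineRatio 1 n = n := by
  induction n using Nat.twoStepInduction with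
  | zero => simp [sineRatio]
  | one => simp [sineRatio]
  | more n h1 h2 => rw [sineRatio, h1, h2]; push_cast; ring

theorem sineRatio_cos_mul_sin (θ : ℝ) (n : ℕ) :
    sineRatio (Real.cos θ) n * Real.sin θ = Real.sin (n * θ) := by
  induction n using Nat.twoStepInduction with
  | zero => simp [sineRatio]
  | one => simp [sineRatio]
  | more n h1 h2 =>
    rw [sineRatio, sub_mul, mul_assoc, h1, h2]
    have e1 : ((n + 2 : ℕ) : ℝ) * θ = ((n + 1 : ℕ) : ℝ) * θ + θ := by push_cast; ring
    have e2 : (n : ℝ) * θ = ((n + 1 : ℕ) : ℝ) * θ - θ := by push_cast; ring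
    rw [e1, e2, Real.sin_add, Real.sin_sub]; ring

variable {E : Type*} [AddCommGroup E] [Module ℝ E]

/-- The reflection `x ↦ x - 2 f(x) a`. -/
def reflectionMap (f : E →ₗ[ℝ] ℝ) (a : E) : Module.End ℝ E :=
  LinearMap.id - (2 : ℝ) • f.smulRight a

theorem reflectionMap_apply (f : E →ₗ[ℝ] ℝ) (a x : E) :
    reflectionMap f a x = x - (2 * f x) • a := by
  simp [reflectionMap, smul_smul]

variable {f g : E →ₗ[ℝ] ℝ} {a b : E} {c : ℝ}

theorem reflectionMap_mul_self (hfa : f a = 1) : reflectionMap f a * reflectionMap f a = 1 := by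
  ext x
  simp only [Module.End.mul_apply, reflectionMap_apply, map_sub, map_smul, hfa, Module.End.one_apply]
  module

theorem reflectionMap_mul_pow_apply (hfa : f a = 1) (hgb : g b = 1) (hfb : f b = -c)
    (hga : g a = -c) (n : ℕ) :
    ((reflectionMap f a * reflectionMap g b) ^ n) a =
      sineRatio c (2 * n + 1) • a + sineRatio c (2 * n) • b := by
  induction n with
  | zero => simp [sineRatio]
  | succ n ih =>
    rw [pow_succ', Module.End.mul_apply, ih, show 2 * (n + 1) = 2 * n + 2 by ring, sineRatio,
      sineRatio]
    simp only [Module.End.mul_apply, reflectionMap_apply, map_sub, map_add, map_smul, hfa, hgb,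
      hfb, hga]
    module

theorem reflectionMap_mul_pow_apply' (hfa : f a = 1) (hgb : g b = 1) (hfb : f b = -c)
    (hga : g a = -c) (n : ℕ) :
    reflectionMap g b (((reflectionMap f a * reflectionMap g b) ^ n) a) =
      sineRatio c (2 * n + 1) • a + sineRatio c (2 * n + 2) • b := by
  rw [reflectionMap_mul_pow_apply hfa hgb hfb hga, sineRatio]
  simp only [reflectionMap_apply, map_add, map_smul, hgb, hga]
  module

/-- The dihedral relation for two reflections at angle `π / m`. -/
theorem reflectionMap_mul_pow_eq_one {m : ℕ} (hm : 2 ≤ m) (hc : c = Real.cos (Real.pi / m))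
    (hfa : f a = 1) (hgb : g b = 1) (hfb : f b = -c) (hga : g a = -c) :
    (reflectionMap f a * reflectionMap g b) ^ m = 1 := by
  have hm0 : (0 : ℝ) < m := by positivity
  have hsin : 0 < Real.sin (Real.pi / m) := by
    apply Real.sin_pos_of_pos_of_lt_pi (by positivity)
    rw [div_lt_iff₀ hm0]
    have : (2 : ℝ) ≤ m := by exact_mod_cast hm
    nlinarith [Real.pi_pos]
  have hU : sineRatio c (2 * m) = 0 := by
    have h := sineRatio_cos_mul_sin (Real.pi / m) (2 * m)
    rw [← hc, show ((2 * m : ℕ) : ℝ) * (Real.pi / m) = 2 * Real.pi by push_cast; field_simp,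
      Real.sin_two_pi] at h
    exact (mul_eq_zero.1 h).resolve_right hsin.ne'
  have hU' : sineRatio c (2 * m + 1) = 1 := by
    have h := sineRatio_cos_mul_sin (Real.pi / m) (2 * m + 1)
    rw [← hc, show ((2 * m + 1 : ℕ) : ℝ) * (Real.pi / m) = Real.pi / m + 2 * Real.pi by
      push_cast; field_simp; ring, Real.sin_add_two_pi] at h
    exact mul_right_cancel₀ hsin.ne' (h.trans (one_mul _).symm)
  have ha : ((reflectionMap f a * reflectionMap g b) ^ m) a = a := by
    rw [reflectionMap_mul_pow_apply hfa hgb hfb hga, hU, hU']; simp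
  have hb : ((reflectionMap f a * reflectionMap g b) ^ m) b = b := by
    have h1 : ((reflectionMap g b * reflectionMap f a) ^ m) b = b := by
      rw [reflectionMap_mul_pow_apply hgb hfa hga hfb, hU, hU']; simp
    have h2 : (reflectionMap f a * reflectionMap g b) ^ m *
        (reflectionMap g b * reflectionMap f a) ^ m = 1 := by
      have hab : (reflectionMap f a * reflectionMap g b) *
          (reflectionMap g b * reflectionMap f a) = 1 := by
        rw [mul_assoc, ← mul_assoc (reflectionMap g b), reflectionMap_mul_self hgb, one_mul,
          reflectionMap_mul_self hfa]
      have hba : (reflectionMap g b * reflectionMap f a) *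
          (reflectionMap f a * reflectionMap g b) = 1 := by
        rw [mul_assoc, ← mul_assoc (reflectionMap f a), reflectionMap_mul_self hfa, one_mul,
          reflectionMap_mul_self hgb]
      have hcomm : Commute (reflectionMap f a * reflectionMap g b)
          (reflectionMap g b * reflectionMap f a) := hab.trans hba.symm
      rw [← hcomm.mul_pow, hab, one_pow]
    have h3 := LinearMap.congr_fun h2 b
    rwa [Module.End.mul_apply, h1, Module.End.one_apply] at h3
  have hdet : (1 - c ^ 2) ≠ 0 := by
    rw [hc, ← Real.sin_sq]; positivity
  ext x
  set p := (f x + c * g x) / (1 - c ^ 2) with hp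
  set q := (g x + c * f x) / (1 - c ^ 2) with hq
  set y := x - p • a - q • b with hy
  have hfy : f y = 0 := by
    simp only [hy, map_sub, map_smul, hfa, hfb, smul_eq_mul, hp, hq]; field_simp; ring
  have hgy : g y = 0 := by
    simp only [hy, map_sub, map_smul, hga, hgb, smul_eq_mul, hp, hq]; field_simp; ring
  have hfix : ∀ n : ℕ, ((reflectionMap f a * reflectionMap g b) ^ n) y = y := by
    intro n
    induction n with
    | zero => simp
    | succ n ih =>
      rw [pow_succ, Module.End.mul_apply, Module.End.mul_apply, reflectionMap_apply g, hgy,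
        mul_zero, zero_smul, sub_zero, reflectionMap_apply, hfy, mul_zero, zero_smul, sub_zero, ih]
  have hx : x = y + p • a + q • b := by rw [hy]; abel
  rw [hx, map_add, map_add, map_smul, map_smul, ha, hb, hfix, Module.End.one_apply]

end DihedralPlane

section GeometricRepresentation

variable (M : CoxeterMatrix B)

/-- The Gram matrix `-cos (π / m_{s,t})` of a Coxeter matrix. -/
def gramMatrix : Matrix B B ℝ := fun s t => if M s t = 0 then -1 else -Real.cos (Real.pi / M s t)

theorem gramMatrix_self (s : B) : gramMatrix M s s = 1 := by simp [gramMatrix]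

theorem gramMatrix_symm (s t : B) : gramMatrix M s t = gramMatrix M t s := by
  simp [gramMatrix, M.symmetric s t]

theorem gramMatrix_alternating_nonneg {M : CoxeterMatrix B} {s t : B} {k : ℕ} (hst : s ≠ t)
    (hk : M s t ≠ 0 → k ≤ M s t) : 0 ≤ sineRatio (-gramMatrix M s t) k := by
  by_cases h0 : M s t = 0
  · rw [gramMatrix, if_pos h0, neg_neg, sineRatio_one]; positivity
  have hk := hk h0
  have h1 := M.off_diagonal s t hst
  have hm : (2 : ℝ) ≤ M s t := by exact_mod_cast (by omega : 2 ≤ M s t)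
  rw [gramMatrix, if_neg h0, neg_neg]
  have hsin : 0 < Real.sin (Real.pi / M s t) := by
    apply Real.sin_pos_of_pos_of_lt_pi (by positivity)
    rw [div_lt_iff₀ (by positivity)]
    nlinarith [Real.pi_pos]
  refine nonneg_of_mul_nonneg_left ?_ hsin
  rw [sineRatio_cos_mul_sin]
  apply Real.sin_nonneg_of_nonneg_of_le_pi (by positivity)
  rw [mul_div_assoc', div_le_iff₀ (by positivity), mul_comm]
  have : (k : ℝ) ≤ M s t := by exact_mod_cast hk
  exact mul_le_mul_of_nonneg_left this Real.pi_pos.le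

variable [Fintype B]

open Classical in
/-- The standard bilinear form, extended to the sum of the standard module and its dual so as to
become non-degenerate. -/
def extendedForm : LinearMap.BilinForm ℝ (B ⊕ B → ℝ) :=
  Matrix.toBilin' (Matrix.fromBlocks (gramMatrix M) 1 1 0)

open Classical in
/-- The simple root of `s`. -/
def simpleRoot (s : B) : B ⊕ B → ℝ := Pi.single (Sum.inl s) 1

open Classical in
/-- The vector of the extended module dual to the simple root of `s`. -/
def dualRoot (s : B) : B ⊕ B → ℝ := Pi.single (Sum.inr s) 1

theorem extendedForm_comm (x y : B ⊕ B → ℝ) : extendedForm M x y = extendedForm M y x := by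
  classical
  have h : (Matrix.fromBlocks (gramMatrix M) (1 : Matrix B B ℝ) (1 : Matrix B B ℝ)
      (0 : Matrix B B ℝ)).IsSymm := by
    refine Matrix.IsSymm.fromBlocks ?_ (by simp) (by simp)
    ext s t
    exact gramMatrix_symm M t s
  simp only [extendedForm, Matrix.toBilin'_apply']
  rw [Matrix.dotProduct_mulVec, ← Matrix.mulVec_transpose, h.eq, dotProduct_comm]

theorem extendedForm_simpleRoot (s t : B) :
    extendedForm M (simpleRoot s) (simpleRoot t) = gramMatrix M s t := by
  classical
  simp [extendedForm, simpleRoot, Matrix.toBilin'_single]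

theorem extendedForm_simpleRoot_self (s : B) :
    extendedForm M (simpleRoot s) (simpleRoot s) = 1 := by
  rw [extendedForm_simpleRoot, gramMatrix_self]

theorem extendedForm_dualRoot (s : B) (x : B ⊕ B → ℝ) :
    extendedForm M (dualRoot s) x = x (Sum.inl s) := by
  classical
  rw [extendedForm, dualRoot, Matrix.toBilin'_apply', single_one_dotProduct,
    Matrix.mulVec, ← Sum.elim_comp_inl_inr x]
  simp [dotProduct, Matrix.fromBlocks_apply₂₁, Matrix.one_apply]

variable {M} (cs : CoxeterSystem M W)

theorem isLiftable_reflectionMap :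
    M.IsLiftable fun s => reflectionMap (extendedForm M (simpleRoot s)) (simpleRoot s) := by
  intro s t
  by_cases hst : s = t
  · subst hst
    rw [M.diagonal, pow_one, reflectionMap_mul_self (extendedForm_simpleRoot_self M s)]
  by_cases h0 : M s t = 0
  · rw [h0, pow_zero]
  have h1 := M.off_diagonal s t hst
  refine reflectionMap_mul_pow_eq_one (by omega) rfl (extendedForm_simpleRoot_self M s)
    (extendedForm_simpleRoot_self M t) ?_ ?_
  · rw [extendedForm_simpleRoot, gramMatrix, if_neg h0]
  · rw [extendedForm_simpleRoot, gramMatrix_symm, gramMatrix, if_neg h0]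

/-- The geometric representation on the extended module. -/
def geomRep : W →* Module.End ℝ (B ⊕ B → ℝ) := cs.lift ⟨_, isLiftable_reflectionMap⟩

theorem geomRep_simple (s : B) :
    geomRep cs (cs.simple s) = reflectionMap (extendedForm M (simpleRoot s)) (simpleRoot s) :=
  cs.lift_apply_simple isLiftable_reflectionMap s

theorem geomRep_simple_apply (s : B) (x : B ⊕ B → ℝ) :
    geomRep cs (cs.simple s) x = x - (2 * extendedForm M (simpleRoot s) x) • simpleRoot s := by
  rw [geomRep_simple, reflectionMap_apply]

theorem geomRep_simple_simpleRoot (s : B) :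
    geomRep cs (cs.simple s) (simpleRoot s) = -simpleRoot s := by
  rw [geomRep_simple_apply, extendedForm_simpleRoot_self]; module

theorem geomRep_mul_apply (v w : W) (x : B ⊕ B → ℝ) :
    geomRep cs (v * w) x = geomRep cs v (geomRep cs w x) := by
  rw [map_mul, Module.End.mul_apply]

theorem geomRep_inv_apply_apply (w : W) (x : B ⊕ B → ℝ) :
    geomRep cs w⁻¹ (geomRep cs w x) = x := by
  rw [← geomRep_mul_apply, inv_mul_cancel, map_one, Module.End.one_apply]

theorem geomRep_apply_inv_apply (w : W) (x : B ⊕ B → ℝ) :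
    geomRep cs w (geomRep cs w⁻¹ x) = x := by
  rw [← geomRep_mul_apply, mul_inv_cancel, map_one, Module.End.one_apply]

theorem geomRep_injective_apply (w : W) : Function.Injective (geomRep cs w) :=
  Function.LeftInverse.injective (geomRep_inv_apply_apply cs w)

theorem extendedForm_geomRep (w : W) (x y : B ⊕ B → ℝ) :
    extendedForm M (geomRep cs w x) (geomRep cs w y) = extendedForm M x y := by
  induction w using cs.simple_induction_left with
  | one => simp
  | mul_simple_left w s ih =>
    rw [geomRep_mul_apply, geomRep_mul_apply, geomRep_simple_apply, geomRep_simple_apply]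
    simp only [map_sub, map_smul, LinearMap.sub_apply, LinearMap.smul_apply, smul_eq_mul, ih,
      extendedForm_simpleRoot_self, extendedForm_comm M _ (simpleRoot s)]
    ring

theorem geomRep_apply_inr (w : W) (x : B ⊕ B → ℝ) (t : B) :
    geomRep cs w x (Sum.inr t) = x (Sum.inr t) := by
  induction w using cs.simple_induction_left with
  | one => simp
  | mul_simple_left w s ih =>
    rw [geomRep_mul_apply, geomRep_simple_apply]
    simp [simpleRoot, ih]

theorem exists_geomRep_alternatingWord {s t : B} {k : ℕ} (hst : s ≠ t)
    (hk : M s t ≠ 0 → k < M s t) :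
    ∃ p q : ℝ, 0 ≤ p ∧ 0 ≤ q ∧
      geomRep cs (cs.wordProd (CoxeterSystem.alternatingWord s t k)) (simpleRoot s) =
        p • simpleRoot s + q • simpleRoot t := by
  have hfa := extendedForm_simpleRoot_self M s
  have hgb := extendedForm_simpleRoot_self M t
  have hfb : extendedForm M (simpleRoot s) (simpleRoot t) = -(-gramMatrix M s t) := by
    rw [neg_neg, extendedForm_simpleRoot]
  have hga : extendedForm M (simpleRoot t) (simpleRoot s) = -(-gramMatrix M s t) := by
    rw [extendedForm_comm, hfb]
  have h1 := gramMatrix_alternating_nonneg (M := M) (k := k) hst fun h => (hk h).le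
  have h2 := gramMatrix_alternating_nonneg (M := M) (k := k + 1) hst fun h => hk h
  rw [cs.prod_alternatingWord_eq_mul_pow, geomRep_mul_apply, map_pow, map_mul, geomRep_simple,
    geomRep_simple]
  rcases Nat.even_or_odd' k with ⟨n, rfl | rfl⟩
  · rw [if_pos (even_two_mul n), map_one, Module.End.one_apply, Nat.mul_div_cancel_left n two_pos,
      reflectionMap_mul_pow_apply hfa hgb hfb hga]
    exact ⟨_, _, h2, h1, rfl⟩
  · rw [if_neg (by simp), show (2 * n + 1) / 2 = n by omega, geomRep_simple,
      reflectionMap_mul_pow_apply' hfa hgb hfb hga]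
    exact ⟨_, _, h1, h2, rfl⟩

end GeometricRepresentation

section Positivity

open CoxeterSystem

variable {M : CoxeterMatrix B} (cs : CoxeterSystem M W)

theorem exists_length_add_alternatingWord_maximal {s t : B} {w : W} (ht : cs.IsRightDescent w t) :
    ∃ (v : W) (k : ℕ), 1 ≤ k ∧ w = v * cs.wordProd (alternatingWord s t k) ∧
      cs.length v + k = cs.length w ∧ ∀ v' : W,
        w = v' * cs.wordProd (alternatingWord s t (k + 1)) →
          cs.length v' + (k + 1) ≠ cs.length w := by
  classical
  let P : ℕ → Prop := fun k => ∃ v : W, w = v * cs.wordProd (alternatingWord s t k) ∧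
    cs.length v + k = cs.length w
  have hP1 : P 1 := by
    refine ⟨w * cs.simple t, ?_, cs.isRightDescent_iff.1 ht⟩
    simp [alternatingWord]
  have hPle : ∀ k, P k → k ≤ cs.length w := by
    rintro k ⟨v, -, hv⟩
    omega
  have h1 : 1 ≤ cs.length w := hPle 1 hP1
  obtain ⟨v, hv, hl⟩ := Nat.findGreatest_spec h1 hP1
  refine ⟨v, _, Nat.le_findGreatest h1 hP1, hv, hl, fun v' hv' hl' => ?_⟩
  have := Nat.le_findGreatest (P := P) (hPle _ ⟨v', hv', hl'⟩) ⟨v', hv', hl'⟩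
  omega

theorem length_alternatingWord_factor_lt {s t : B} {v w : W} {k : ℕ}
    (hw : w = v * cs.wordProd (alternatingWord s t k)) (hl : cs.length v + k = cs.length w)
    (hs : ¬ cs.IsRightDescent w s) (hM : M s t ≠ 0) : k < M s t := by
  have hle := cs.length_mul_le v (cs.wordProd (alternatingWord s t k))
  rw [← hw] at hle
  by_contra! hk
  rcases hk.lt_or_eq with hk | hk
  · have h1 := cs.not_isReduced_alternatingWord s t hM hk
    have h2 := cs.length_wordProd_le (alternatingWord s t k)
    rw [CoxeterSystem.IsReduced, length_alternatingWord] at h1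
    rw [length_alternatingWord] at h2
    omega
  · obtain ⟨n, rfl⟩ : ∃ n, k = n + 1 := ⟨k - 1, by omega⟩
    have hb := cs.wordProd_braidWord_eq s t
    rw [braidWord, braidWord, M.symmetric t s, hk, alternatingWord_succ t s,
      wordProd_concat] at hb
    have h3 : w * cs.simple s = v * cs.wordProd (alternatingWord s t n) := by
      rw [hw, hb, mul_assoc, simple_mul_simple_cancel_right]
    have h4 := cs.length_mul_le v (cs.wordProd (alternatingWord s t n))
    have h5 := cs.length_wordProd_le (alternatingWord s t n)
    rw [length_alternatingWord] at h5
    apply hs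
    rw [IsRightDescent, h3]
    omega

theorem exists_dihedral_factorization {s t : B} {w : W} (hs : ¬ cs.IsRightDescent w s)
    (ht : cs.IsRightDescent w t) :
    ∃ (v : W) (k : ℕ), w = v * cs.wordProd (alternatingWord s t k) ∧
      cs.length v < cs.length w ∧ ¬ cs.IsRightDescent v s ∧ ¬ cs.IsRightDescent v t ∧
      (M s t ≠ 0 → k < M s t) := by
  obtain ⟨v, k, hk, hw, hl, hmax⟩ := exists_length_add_alternatingWord_maximal cs (s := s) ht
  refine ⟨v, k, hw, by omega, ?_⟩
  rw [← and_assoc]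
  refine ⟨?_, fun hM => length_alternatingWord_factor_lt cs hw hl hs hM⟩
  have hnext : ¬ cs.IsRightDescent v (if Even k then t else s) := by
    intro h
    refine hmax (v * cs.simple (if Even k then t else s)) ?_ ?_
    · rw [alternatingWord_succ', wordProd_cons, ← mul_assoc, simple_mul_simple_cancel_right, ← hw]
    · have := cs.isRightDescent_iff.1 h
      omega
  have hfirst : ¬ cs.IsRightDescent v (if Even k then s else t) := by
    intro h
    obtain ⟨n, rfl⟩ : ∃ n, k = n + 1 := ⟨k - 1, by omega⟩
    have h1 : (if Even (n + 1) then s else t) = if Even n then t else s := by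
      by_cases hn : Even n
      · rw [if_pos hn, if_neg (by rw [Nat.even_add_one]; exact not_not.2 hn)]
      · rw [if_neg hn, if_pos (Nat.even_add_one.2 hn)]
    rw [h1] at h
    have h2 := cs.length_mul_le (v * cs.simple (if Even n then t else s))
      (cs.wordProd (alternatingWord s t n))
    have h3 := cs.length_wordProd_le (alternatingWord s t n)
    rw [length_alternatingWord] at h3
    rw [mul_assoc, ← wordProd_cons, ← alternatingWord_succ', ← hw] at h2
    have h4 := cs.isRightDescent_iff.1 h
    omega
  by_cases he : Even k
  · rw [if_pos he] at hnext hfirst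
    exact ⟨hfirst, hnext⟩
  · rw [if_neg he] at hnext hfirst
    exact ⟨hnext, hfirst⟩

theorem simpleRoot_apply_inl_self (s : B) : simpleRoot s (Sum.inl s) = 1 := by
  simp [simpleRoot]

theorem simpleRoot_ne_zero (s : B) : simpleRoot s ≠ 0 := fun h => by
  have := simpleRoot_apply_inl_self s
  simp [h] at this

theorem simpleRoot_apply_inr (s t : B) : simpleRoot s (Sum.inr t) = 0 := by
  simp [simpleRoot]

variable [Fintype B]

/-- Roots are positive or negative according to the descents of `w`. -/
theorem geomRep_simpleRoot_nonneg {w : W} {s : B} (hs : ¬ cs.IsRightDescent w s) (u : B) :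
    0 ≤ geomRep cs w (simpleRoot s) (Sum.inl u) := by
  classical
  induction hn : cs.length w using Nat.strong_induction_on generalizing w s with
  | _ n ih =>
    subst hn
    by_cases hw : w = 1
    · rw [hw, map_one, Module.End.one_apply, simpleRoot, Pi.single_apply]
      split_ifs <;> norm_num
    · obtain ⟨t, ht⟩ := cs.exists_rightDescent_of_ne_one hw
      have hst : s ≠ t := by rintro rfl; exact hs ht
      obtain ⟨v, k, rfl, hl, hvs, hvt, hk⟩ := exists_dihedral_factorization cs hs ht
      obtain ⟨p, q, hp, hq, he⟩ := exists_geomRep_alternatingWord cs hst hk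
      have h1 := ih _ hl hvs rfl
      have h2 := ih _ hl hvt rfl
      rw [geomRep_mul_apply, he, map_add, map_smul, map_smul]
      simp only [Pi.add_apply, Pi.smul_apply, smul_eq_mul]
      positivity

theorem geomRep_simpleRoot_nonpos {w : W} {s : B} (hs : cs.IsRightDescent w s) (u : B) :
    geomRep cs w (simpleRoot s) (Sum.inl u) ≤ 0 := by
  have h := geomRep_simpleRoot_nonneg cs (cs.isRightDescent_iff_not_isRightDescent_mul.1 hs) u
  rw [geomRep_mul_apply, geomRep_simple_simpleRoot, map_neg, Pi.neg_apply] at h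
  linarith

/-- The geometric representation is faithful, already on the simple roots. -/
theorem eq_one_of_geomRep_simpleRoot {w : W} (h : ∀ s, geomRep cs w (simpleRoot s) = simpleRoot s) :
    w = 1 := by
  by_contra hw
  obtain ⟨t, ht⟩ := cs.exists_rightDescent_of_ne_one hw
  have := geomRep_simpleRoot_nonpos cs ht t
  rw [h, simpleRoot_apply_inl_self] at this
  linarith

theorem geomRep_injective : Function.Injective (geomRep cs) := by
  rw [injective_iff_map_eq_one]
  intro w hw
  exact eq_one_of_geomRep_simpleRoot cs fun s => by rw [hw, Module.End.one_apply]

/-- Two root vectors cannot be opposite unless one of the elements has the descent. -/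
theorem isRightDescent_of_geomRep_eq_neg {v w : W} {s t : B}
    (h : geomRep cs v (simpleRoot s) = -geomRep cs w (simpleRoot t))
    (hw : ¬ cs.IsRightDescent w t) : cs.IsRightDescent v s := by
  by_contra hv
  apply simpleRoot_ne_zero s
  apply geomRep_injective_apply cs v
  rw [map_zero]
  funext u
  rcases u with u | u
  · have h1 := geomRep_simpleRoot_nonneg cs hv u
    have h2 := geomRep_simpleRoot_nonneg cs hw u
    rw [h, Pi.neg_apply] at h1
    rw [h, Pi.neg_apply, Pi.zero_apply]
    linarith
  · rw [geomRep_apply_inr, simpleRoot_apply_inr, Pi.zero_apply]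

end Positivity

section Irreducible

variable {M : CoxeterMatrix B} (cs : CoxeterSystem M W)

theorem forall_of_connected {V : Type*} {Γ : SimpleGraph V} (hΓ : Γ.Preconnected) {P : V → Prop}
    (hP : ∀ s t, Γ.Adj s t → P s → P t) {s : V} (hs : P s) (t : V) : P t := by
  have h := (SimpleGraph.reachable_iff_reflTransGen s t).1 (hΓ s t)
  induction h with
  | refl => exact hs
  | tail _ h ih => exact hP _ _ h ih

theorem gramMatrix_ne_zero {s t : B} (h : (coxeterGraph M).Adj s t) : gramMatrix M s t ≠ 0 := by
  rw [coxeterGraph, SimpleGraph.fromRel_adj, M.symmetric t s, or_self] at h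
  rw [gramMatrix]
  split_ifs with h0
  · norm_num
  · have h3 : (3 : ℝ) ≤ M s t := by exact_mod_cast h.2.resolve_left h0
    rw [neg_ne_zero]
    apply (Real.cos_pos_of_mem_Ioo ⟨?_, ?_⟩).ne'
    · have : 0 < Real.pi / M s t := by positivity
      linarith [Real.pi_pos]
    · exact div_lt_div_of_pos_left Real.pi_pos two_pos (by linarith)

theorem finite_of_length_le {n : ℕ} (h : ∀ w, cs.length w ≤ n) [Finite B] : Finite W := by
  have hfin : {l : List B | l.length ≤ n}.Finite := List.finite_length_le B n
  refine Set.finite_univ_iff.1 ((hfin.image cs.wordProd).subset fun w _ => ?_)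
  obtain ⟨l, hl, rfl⟩ := cs.exists_isReduced w
  exact ⟨l, hl.eq.symm.trans_le (h _), rfl⟩

variable [Fintype B]

theorem geomRep_simpleRoot_eq_smul_of_commute {w : W} {s : B} (h : Commute w (cs.simple s)) :
    geomRep cs w (simpleRoot s) =
      extendedForm M (simpleRoot s) (geomRep cs w (simpleRoot s)) • simpleRoot s := by
  have h1 : geomRep cs (w * cs.simple s) (simpleRoot s) =
      geomRep cs (cs.simple s * w) (simpleRoot s) := by rw [h.eq]
  rw [geomRep_mul_apply, geomRep_mul_apply, geomRep_simple_simpleRoot, map_neg,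
    geomRep_simple_apply] at h1
  set y := geomRep cs w (simpleRoot s)
  set d := extendedForm M (simpleRoot s) y
  have h2 : (2 : ℝ) • y = (2 : ℝ) • d • simpleRoot s := by
    rw [smul_smul, ← sub_eq_zero, ← neg_eq_zero, ← sub_eq_zero.2 h1]
    module
  exact smul_right_injective _ two_ne_zero h2

theorem length_mul_add_length_of_geomRep_eq_neg {z : W} (hz : z ∈ Subgroup.center W)
    (h : ∀ s, geomRep cs z (simpleRoot s) = -simpleRoot s) (w : W) :
    cs.length (z * w) + cs.length w = cs.length z := by
  induction hn : cs.length w generalizing w with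
  | zero => rw [cs.length_eq_zero_iff.1 hn, mul_one, add_zero]
  | succ n ih =>
    have hw : w ≠ 1 := by
      rintro rfl
      simp at hn
    obtain ⟨t, ht⟩ := cs.exists_rightDescent_of_ne_one hw
    have h1 := cs.isRightDescent_iff.1 ht
    have h2 := ih (w * cs.simple t) (by omega)
    have h3 : cs.IsRightDescent (z * (w * cs.simple t)) t := by
      refine isRightDescent_of_geomRep_eq_neg cs (w := w * cs.simple t) (t := t) ?_
        (cs.isRightDescent_iff_not_isRightDescent_mul.1 ht)
      rw [← Subgroup.mem_center_iff.1 hz, geomRep_mul_apply, h, map_neg]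
    have h4 := cs.isRightDescent_iff.1 h3
    rw [← mul_assoc, cs.simple_mul_simple_cancel_right] at h4
    rw [← mul_assoc] at h2
    omega

/-- An infinite irreducible Coxeter group has trivial center. -/
theorem center_eq_bot_of_connected (cs : CoxeterSystem M W) [Infinite W]
    (hconn : (coxeterGraph M).Connected) : Subgroup.center W = ⊥ := by
  rw [Subgroup.eq_bot_iff_forall]
  intro z hz
  have hcomm := fun s => geomRep_simpleRoot_eq_smul_of_commute cs
    ((Subgroup.mem_center_iff.1 hz (cs.simple s)).symm)
  set c : B → ℝ := fun s => extendedForm M (simpleRoot s) (geomRep cs z (simpleRoot s)) with hc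
  have hcomm : ∀ s, geomRep cs z (simpleRoot s) = c s • simpleRoot s := hcomm
  have hform : ∀ s t, c s * c t * gramMatrix M s t = gramMatrix M s t := fun s t => by
    have h := extendedForm_geomRep cs z (simpleRoot s) (simpleRoot t)
    rw [hcomm, hcomm t] at h
    simp only [map_smul, LinearMap.smul_apply, smul_eq_mul, extendedForm_simpleRoot] at h
    linarith
  have hsq : ∀ s, c s * c s = 1 := fun s => by
    have := hform s s
    rwa [gramMatrix_self, mul_one] at this
  have hadj : ∀ s t, (coxeterGraph M).Adj s t → c s = c t := fun s t hst => by
    have h1 := mul_right_cancel₀ (gramMatrix_ne_zero hst) ((hform s t).trans (one_mul _).symm)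
    have h2 := hsq t
    have h3 : c t ≠ 0 := by rintro h; simp [h] at h2
    exact mul_right_cancel₀ h3 (h1.trans h2.symm)
  obtain ⟨s₀⟩ := hconn.nonempty
  have hconst : ∀ s, c s = c s₀ :=
    forall_of_connected hconn.preconnected (fun s t hst h => (hadj s t hst).symm.trans h) rfl
  rcases mul_self_eq_one_iff.1 (hsq s₀) with h | h
  · exact eq_one_of_geomRep_simpleRoot cs fun s => by rw [hcomm, hconst, h, one_smul]
  · have hneg : ∀ s, geomRep cs z (simpleRoot s) = -simpleRoot s := fun s => by
      rw [hcomm, hconst, h, neg_one_smul]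
    refine ((not_finite_iff_infinite.2 ‹Infinite W›) (finite_of_length_le cs (n := cs.length z)
      fun w => ?_)).elim
    have := length_mul_add_length_of_geomRep_eq_neg cs hz hneg w
    omega

theorem geomRep_conj_simple_apply (w : W) (s : B) (x : B ⊕ B → ℝ) :
    geomRep cs (w * cs.simple s * w⁻¹) x =
      x - (2 * extendedForm M (geomRep cs w (simpleRoot s)) x) • geomRep cs w (simpleRoot s) := by
  rw [geomRep_mul_apply, geomRep_mul_apply, geomRep_simple_apply, map_sub, map_smul,
    geomRep_apply_inv_apply, ← extendedForm_geomRep cs w (simpleRoot s) (geomRep cs w⁻¹ x),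
    geomRep_apply_inv_apply]

theorem exists_coord_ne_zero_of_not_commute {w : W} {s : B} (h : ¬ Commute w (cs.simple s)) :
    ∃ t, t ≠ s ∧ geomRep cs w (simpleRoot s) (Sum.inl t) ≠ 0 := by
  classical
  contrapose! h
  set d := geomRep cs w (simpleRoot s) (Sum.inl s) with hd
  have h1 : geomRep cs w (simpleRoot s) = d • simpleRoot s := by
    funext u
    rcases u with u | u
    · by_cases hu : u = s
      · subst hu
        rw [Pi.smul_apply, simpleRoot_apply_inl_self, smul_eq_mul, mul_one]
      · rw [h u hu]
        simp [simpleRoot, hu]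
    · rw [geomRep_apply_inr, Pi.smul_apply, simpleRoot_apply_inr, smul_zero]
  have h2 : d * d = 1 := by
    have := extendedForm_geomRep cs w (simpleRoot s) (simpleRoot s)
    rw [h1] at this
    simpa [extendedForm_simpleRoot_self] using this
  have h3 : w * cs.simple s * w⁻¹ = cs.simple s := by
    apply geomRep_injective cs
    refine LinearMap.ext fun x => ?_
    rw [geomRep_conj_simple_apply, geomRep_simple_apply, h1, map_smul, LinearMap.smul_apply,
      smul_eq_mul, smul_smul, mul_assoc 2, mul_right_comm, h2, one_mul]
  exact mul_inv_eq_iff_eq_mul.1 h3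

end Irreducible

section Indecomposable

variable {M : CoxeterMatrix B} (cs : CoxeterSystem M W)

section Plane

variable [Fintype B]

/-- An element commuting with a product of two distinct reflections preserves the plane spanned by
their roots. -/
theorem geomRep_mem_span_of_commute {k a : W} {s t : B} (hts : t ≠ s)
    (ht : geomRep cs k (simpleRoot s) (Sum.inl t) ≠ 0)
    (ha : Commute a (cs.simple s * (k * cs.simple s * k⁻¹))) {x : B ⊕ B → ℝ}
    (hx : x ∈ Submodule.span ℝ {simpleRoot s, geomRep cs k (simpleRoot s)}) :
    geomRep cs a x ∈ Submodule.span ℝ {simpleRoot s, geomRep cs k (simpleRoot s)} := by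
  set β := geomRep cs k (simpleRoot s) with hβ
  set P := Submodule.span ℝ {simpleRoot s, β} with hP
  set r := cs.simple s * (k * cs.simple s * k⁻¹) with hr
  have he : simpleRoot s ∈ P := Submodule.subset_span (by simp)
  have hb : β ∈ P := Submodule.subset_span (by simp)
  have hrx : ∀ x, geomRep cs r x = x - (2 * extendedForm M β x) • β -
      (2 * (extendedForm M (simpleRoot s) x -
        2 * extendedForm M β x * extendedForm M (simpleRoot s) β)) • simpleRoot s := fun x => by
    rw [hr, geomRep_mul_apply, geomRep_conj_simple_apply, geomRep_simple_apply, ← hβ, map_sub,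
      map_smul, smul_eq_mul]
  have hmem : ∀ x, x - geomRep cs r x ∈ P := fun x => by
    rw [hrx, sub_sub, sub_sub_cancel]
    exact P.add_mem (P.smul_mem _ hb) (P.smul_mem _ he)
  have hstab : ∀ x, geomRep cs a (x - geomRep cs r x) ∈ P := fun x => by
    rw [map_sub, ← geomRep_mul_apply, ha.eq, geomRep_mul_apply]
    exact hmem _
  have hes : ∀ u, extendedForm M (simpleRoot s) (dualRoot u) = simpleRoot s (Sum.inl u) :=
    fun u => by rw [extendedForm_comm, extendedForm_dualRoot]
  have hbs : ∀ u, extendedForm M β (dualRoot u) = β (Sum.inl u) := fun u => by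
    rw [extendedForm_comm, extendedForm_dualRoot]
  have hest : simpleRoot s (Sum.inl t) = 0 := by
    classical
    simp [simpleRoot, hts]
  have hae : geomRep cs a (simpleRoot s) ∈ P := by
    have h := hstab ((2⁻¹ : ℝ) • (dualRoot s - (β (Sum.inl s) / β (Sum.inl t)) • dualRoot t))
    rw [hrx] at h
    simp only [map_sub, map_smul, smul_eq_mul, hes, hbs, hest, simpleRoot_apply_inl_self] at h
    rw [div_mul_cancel₀ _ ht] at h
    convert h using 2
    module
  have hab : geomRep cs a β ∈ P := by
    have h := hstab ((2 * β (Sum.inl t))⁻¹ • dualRoot t)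
    rw [hrx, sub_sub, sub_sub_cancel] at h
    simp only [map_smul, smul_eq_mul, hes, hbs, hest] at h
    rw [mul_inv, mul_assoc, inv_mul_cancel₀ ht, mul_one, mul_inv_cancel₀ two_ne_zero, one_smul,
      map_add, map_smul] at h
    exact (P.add_mem_iff_left (P.smul_mem _ hae)).1 h
  have hle : P ≤ P.comap (geomRep cs a) := by
    rw [hP, Submodule.span_le]
    rintro y (rfl | rfl)
    · exact hae
    · exact hab
  exact hle hx

theorem linearIndependent_simpleRoot : LinearIndependent ℝ (simpleRoot : B → B ⊕ B → ℝ) := by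
  classical
  convert (Pi.basisFun ℝ (B ⊕ B)).linearIndependent.comp Sum.inl Sum.inl_injective using 1
  funext s
  simp [simpleRoot]

/-- An invariant plane containing a simple root forces the rank to be at most two. -/
theorem card_le_two_of_invariant_plane (hconn : (coxeterGraph M).Connected) {s : B}
    {β : B ⊕ B → ℝ} (hinv : ∀ (w : W), ∀ x ∈ Submodule.span ℝ {simpleRoot s, β},
      geomRep cs w x ∈ Submodule.span ℝ {simpleRoot s, β}) : Fintype.card B ≤ 2 := by
  classical
  set P := Submodule.span ℝ {simpleRoot s, β} with hP
  have hall : ∀ t, simpleRoot t ∈ P := by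
    refine forall_of_connected hconn.preconnected (fun u t hut hu => ?_)
      (Submodule.subset_span (by simp) : simpleRoot s ∈ P)
    have h1 := hinv (cs.simple t) _ hu
    rw [geomRep_simple_apply, P.sub_mem_iff_right hu, extendedForm_simpleRoot] at h1
    exact (P.smul_mem_iff (mul_ne_zero two_ne_zero (gramMatrix_ne_zero hut.symm))).1 h1
  have h1 : (Submodule.span ℝ (Set.range (simpleRoot : B → B ⊕ B → ℝ))) ≤ P := by
    rw [Submodule.span_le]
    rintro _ ⟨t, rfl⟩
    exact hall t
  calc Fintype.card B = Module.finrank ℝ (Submodule.span ℝ (Set.range simpleRoot)) :=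
        (finrank_span_eq_card (linearIndependent_simpleRoot)).symm
    _ ≤ Module.finrank ℝ P := Submodule.finrank_mono h1
    _ ≤ 2 := by
        have h2 := finrank_span_finset_le_card (R := ℝ) ({simpleRoot s, β} : Finset (B ⊕ B → ℝ))
        rw [Finset.coe_pair] at h2
        exact h2.trans Finset.card_le_two

end Plane

section Dihedral

variable {s t : B}

theorem mem_zpowers_or_of_forall_eq_or (h : ∀ u, u = s ∨ u = t) (w : W) :
    w ∈ Subgroup.zpowers (cs.simple s * cs.simple t) ∨
      w * cs.simple s ∈ Subgroup.zpowers (cs.simple s * cs.simple t) := by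
  set τ := cs.simple s * cs.simple t with hτ
  have hts : cs.simple t * cs.simple s = τ⁻¹ := by
    rw [hτ, mul_inv_rev, cs.inv_simple, cs.inv_simple]
  have hmem : τ ∈ Subgroup.zpowers τ := Subgroup.mem_zpowers τ
  induction w using cs.simple_induction_right with
  | one => exact Or.inl (one_mem _)
  | mul_simple_right w u ih =>
    have hw : w * cs.simple t = w * cs.simple s * τ := by
      rw [hτ, ← mul_assoc, cs.simple_mul_simple_cancel_right]
    have hw' : w * cs.simple t * cs.simple s = w * τ⁻¹ := by rw [mul_assoc, hts]
    rcases ih with ih | ih <;> rcases h u with rfl | rfl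
    · right; rwa [cs.simple_mul_simple_cancel_right]
    · right; rw [hw']; exact mul_mem ih (inv_mem hmem)
    · exact Or.inl ih
    · left; rw [hw]; exact mul_mem ih hmem

theorem simple_mul_conj_mem_zpowers (h : ∀ u, u = s ∨ u = t) (w : W) :
    cs.simple s * (w * cs.simple s * w⁻¹) ∈ Subgroup.zpowers (cs.simple s * cs.simple t) := by
  set τ := cs.simple s * cs.simple t with hτ
  have hconj : ∀ v ∈ Subgroup.zpowers τ,
      cs.simple s * (v * cs.simple s * v⁻¹) ∈ Subgroup.zpowers τ := by
    rintro _ ⟨n, rfl⟩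
    have h1 : cs.simple s * τ ^ n * cs.simple s = (τ ^ n)⁻¹ := by
      have h2 := conj_zpow (i := n) (a := cs.simple s) (b := τ)
      rw [cs.inv_simple] at h2
      rw [← h2, hτ, ← mul_assoc, cs.simple_mul_simple_self, one_mul, ← inv_zpow, mul_inv_rev,
        cs.inv_simple, cs.inv_simple]
    dsimp only
    rw [← mul_assoc, ← mul_assoc, h1, ← mul_inv_rev]
    exact inv_mem (mul_mem (Subgroup.zpow_mem_zpowers _ _) (Subgroup.zpow_mem_zpowers _ _))
  rcases mem_zpowers_or_of_forall_eq_or cs h w with hw | hw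
  · exact hconj w hw
  · have h1 := hconj _ hw
    rwa [cs.simple_mul_simple_cancel_right, mul_inv_rev, cs.inv_simple, ← mul_assoc w] at h1

theorem not_isOfFinOrder_of_forall_eq_or [Infinite W] (h : ∀ u, u = s ∨ u = t) :
    ¬ IsOfFinOrder (cs.simple s * cs.simple t) := by
  intro hfin
  have hZ : ((Subgroup.zpowers (cs.simple s * cs.simple t) : Subgroup W) : Set W).Finite :=
    hfin.finite_zpowers
  refine Set.infinite_univ ((hZ.union (hZ.image (· * cs.simple s))).subset fun w _ => ?_)
  rcases mem_zpowers_or_of_forall_eq_or cs h w with hw | hw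
  · exact Or.inl hw
  · exact Or.inr ⟨_, hw, cs.simple_mul_simple_cancel_right s⟩

end Dihedral

theorem simple_mul_conj_mem {N : Subgroup W} (hN : N.Normal) {k : W} (hk : k ∈ N) (s : B) :
    cs.simple s * (k * cs.simple s * k⁻¹) ∈ N := by
  have h := hN.conj_mem k hk (cs.simple s)
  rw [cs.inv_simple] at h
  rw [← mul_assoc, ← mul_assoc]
  exact mul_mem h (inv_mem hk)

theorem commute_of_forall_eq_or [Infinite W] {A K : Subgroup W} (hA : A.Normal) (hK : K.Normal)
    (hAK : A ⊓ K = ⊥) {s t : B} (h : ∀ u, u = s ∨ u = t) {a k : W} (ha : a ∈ A) (hk : k ∈ K) :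
    Commute k (cs.simple s) ∨ Commute a (cs.simple s) := by
  have hcomm : ∀ w, cs.simple s * (w * cs.simple s * w⁻¹) = 1 → Commute w (cs.simple s) := by
    intro w hw
    have h1 := eq_inv_of_mul_eq_one_right hw
    rw [cs.inv_simple] at h1
    exact mul_inv_eq_iff_eq_mul.1 h1
  obtain ⟨i, hi⟩ := simple_mul_conj_mem_zpowers cs h k
  obtain ⟨j, hj⟩ := simple_mul_conj_mem_zpowers cs h a
  dsimp only at hi hj
  have hKi := simple_mul_conj_mem cs hK hk s
  have hAj := simple_mul_conj_mem cs hA ha s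
  rw [← hi] at hKi
  rw [← hj] at hAj
  have h1 : (cs.simple s * cs.simple t) ^ (i * j) ∈ A ⊓ K := by
    refine Subgroup.mem_inf.2 ⟨?_, ?_⟩
    · rw [mul_comm, zpow_mul]; exact zpow_mem hAj _
    · rw [zpow_mul]; exact zpow_mem hKi _
  rw [hAK, Subgroup.mem_bot] at h1
  have h2 : i * j = 0 := by
    by_contra h2
    exact not_isOfFinOrder_of_forall_eq_or cs h (isOfFinOrder_iff_zpow_eq_one.2 ⟨_, h2, h1⟩)
  rcases mul_eq_zero.1 h2 with rfl | rfl
  · exact Or.inl (hcomm k (by rw [← hi, zpow_zero]))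
  · exact Or.inr (hcomm a (by rw [← hj, zpow_zero]))

theorem eq_top_of_simple_mem {N : Subgroup W} (h : ∀ s, cs.simple s ∈ N) : N = ⊤ := by
  rw [eq_top_iff, ← cs.subgroup_closure_range_simple, Subgroup.closure_le]
  rintro _ ⟨s, rfl⟩
  exact h s

variable [Fintype B]

theorem exists_forall_eq_or_of_card_le_two (h : Fintype.card B ≤ 2) (s : B) :
    ∃ t, ∀ u, u = s ∨ u = t := by
  classical
  by_cases hs : ∃ t, t ≠ s
  · obtain ⟨t, hts⟩ := hs
    refine ⟨t, fun u => ?_⟩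
    by_contra! hu
    have h3 : ({u, s, t} : Finset B).card = 3 := Finset.card_eq_three.2
      ⟨u, s, t, hu.1, hu.2, hts.symm, rfl⟩
    have := Finset.card_le_univ ({u, s, t} : Finset B)
    omega
  · push Not at hs
    exact ⟨s, fun u => Or.inl (hs u)⟩

/-- In a direct decomposition, one of the factors centralizes a given simple reflection. -/
theorem forall_commute_simple_or [Infinite W] (hconn : (coxeterGraph M).Connected)
    {A K : Subgroup W} (hA : A.Normal) (hK : K.Normal) (hAK : A ⊓ K = ⊥)
    (hsup : ∀ g : W, ∃ a ∈ A, ∃ k ∈ K, g = a * k) (s : B) :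
    (∀ k ∈ K, Commute k (cs.simple s)) ∨ ∀ a ∈ A, Commute a (cs.simple s) := by
  by_contra! h
  obtain ⟨⟨k, hk, hks⟩, a, ha, has⟩ := h
  have hcomm := Subgroup.commute_of_normal_of_disjoint A K hA hK (disjoint_iff.2 hAK)
  obtain ⟨t, hts, ht⟩ := exists_coord_ne_zero_of_not_commute cs hks
  obtain ⟨u, hus, hu⟩ := exists_coord_ne_zero_of_not_commute cs has
  have hA' : ∀ a' ∈ A, ∀ x ∈ Submodule.span ℝ {simpleRoot s, geomRep cs k (simpleRoot s)},
      geomRep cs a' x ∈ Submodule.span ℝ {simpleRoot s, geomRep cs k (simpleRoot s)} :=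
    fun a' ha' x hx => geomRep_mem_span_of_commute cs hts ht
      (hcomm _ _ ha' (simple_mul_conj_mem cs hK hk s)) hx
  have hK' : ∀ k' ∈ K, ∀ x ∈ Submodule.span ℝ {simpleRoot s, geomRep cs a (simpleRoot s)},
      geomRep cs k' x ∈ Submodule.span ℝ {simpleRoot s, geomRep cs a (simpleRoot s)} :=
    fun k' hk' x hx => geomRep_mem_span_of_commute cs hus hu
      (hcomm _ _ (simple_mul_conj_mem cs hA ha s) hk').symm hx
  have hspan : Submodule.span ℝ {simpleRoot s, geomRep cs k (simpleRoot s)} =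
      Submodule.span ℝ {simpleRoot s, geomRep cs a (simpleRoot s)} := by
    apply le_antisymm
    · rw [Submodule.span_le]
      rintro y (rfl | rfl)
      · exact Submodule.subset_span (by simp)
      · exact hK' k hk _ (Submodule.subset_span (by simp))
    · rw [Submodule.span_le]
      rintro y (rfl | rfl)
      · exact Submodule.subset_span (by simp)
      · exact hA' a ha _ (Submodule.subset_span (by simp))
  have hcard : Fintype.card B ≤ 2 := by
    refine card_le_two_of_invariant_plane cs hconn (s := s) (β := geomRep cs k (simpleRoot s))
      fun w x hx => ?_
    obtain ⟨a', ha', k', hk', rfl⟩ := hsup w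
    rw [geomRep_mul_apply]
    apply hA' a' ha'
    rw [hspan] at hx ⊢
    exact hK' k' hk' x hx
  obtain ⟨v, hv⟩ := exists_forall_eq_or_of_card_le_two hcard s
  exact (commute_of_forall_eq_or cs hA hK hAK hv ha hk).elim hks has

theorem not_commute_of_adj {s t : B} (h : (coxeterGraph M).Adj s t) :
    ¬ Commute (cs.simple s) (cs.simple t) := by
  intro hst
  have h1 := geomRep_simpleRoot_eq_smul_of_commute cs hst
  have h2 := congrFun h1 (Sum.inl s)
  classical
  have h3 : simpleRoot t (Sum.inl s) = 0 := by simp [simpleRoot, h.ne]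
  rw [geomRep_simple_apply, extendedForm_simpleRoot, Pi.sub_apply, Pi.smul_apply, Pi.smul_apply,
    simpleRoot_apply_inl_self, h3, smul_zero, zero_sub, smul_eq_mul, mul_one, neg_eq_zero] at h2
  exact mul_ne_zero two_ne_zero (gramMatrix_ne_zero h) h2

theorem mem_of_forall_commute_simple {A K : Subgroup W} (hcenter : Subgroup.center W = ⊥)
    (hcomm : ∀ a ∈ A, ∀ k ∈ K, Commute a k) (hsup : ∀ g : W, ∃ a ∈ A, ∃ k ∈ K, g = a * k) {g : W}
    (hg : ∀ a ∈ A, Commute a g) : g ∈ K := by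
  obtain ⟨a, ha, k, hk, rfl⟩ := hsup g
  have h1 : a ∈ Subgroup.center W := by
    rw [Subgroup.mem_center_iff]
    intro x
    obtain ⟨a', ha', k', hk', rfl⟩ := hsup x
    have h2 : Commute a' a := by
      have h3 := (hg a' ha').mul_right (hcomm a' ha' k hk).inv_right
      rwa [mul_inv_cancel_right] at h3
    exact (h2.mul_left (hcomm a ha k' hk').symm).eq
  rw [hcenter, Subgroup.mem_bot] at h1
  rwa [h1, one_mul]

/-- An infinite irreducible Coxeter group is directly indecomposable. -/
theorem isIndecomposableGroup_of_connected (cs : CoxeterSystem M W) [Infinite W]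
    (hconn : (coxeterGraph M).Connected) : IsIndecomposableGroup W := by
  intro A K hA hK hAK hsup
  have hcenter := center_eq_bot_of_connected cs hconn
  have hcomm : ∀ a ∈ A, ∀ k ∈ K, Commute a k := fun a ha k hk =>
    Subgroup.commute_of_normal_of_disjoint A K hA hK (disjoint_iff.2 hAK) a k ha hk
  have hsup' : ∀ g : W, ∃ k ∈ K, ∃ a ∈ A, g = k * a := fun g => by
    obtain ⟨a, ha, k, hk, rfl⟩ := hsup g
    exact ⟨k, hk, a, ha, hcomm a ha k hk⟩
  have hor : ∀ s, cs.simple s ∈ A ∨ cs.simple s ∈ K := fun s =>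
    (forall_commute_simple_or cs hconn hA hK hAK hsup s).imp
      (mem_of_forall_commute_simple hcenter (fun k hk a ha => (hcomm a ha k hk).symm) hsup')
      (mem_of_forall_commute_simple hcenter hcomm hsup)
  obtain ⟨s₀⟩ := hconn.nonempty
  rcases hor s₀ with h | h
  · right
    have hall : A = ⊤ := eq_top_of_simple_mem cs <| forall_of_connected hconn.preconnected
      (fun s t hst hs => (hor t).resolve_right fun ht =>
        not_commute_of_adj cs hst (hcomm _ hs _ ht)) h
    rwa [hall, top_inf_eq] at hAK
  · left
    have hall : K = ⊤ := eq_top_of_simple_mem cs <| forall_of_connected hconn.preconnected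
      (fun s t hst hs => (hor t).resolve_left fun ht =>
        not_commute_of_adj cs hst (hcomm _ ht _ hs).symm) h
    rwa [hall, inf_top_eq] at hAK

end Indecomposable

section Parabolic

variable {M : CoxeterMatrix B} (cs : CoxeterSystem M W)

/-- The Coxeter matrix induced on a subset of the generators. -/
def restrictMatrix (M : CoxeterMatrix B) (Z : Set B) : CoxeterMatrix Z where
  M := fun s t => M s t
  isSymm := by
    ext s t
    exact M.symmetric t s
  diagonal s := M.diagonal s
  off_diagonal s t h := M.off_diagonal s t fun h' => h (Subtype.ext h')

theorem eq_two_of_not_adj {s t : B} (hst : s ≠ t) (h : ¬ (coxeterGraph M).Adj s t) :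
    M s t = 2 := by
  rw [coxeterGraph, SimpleGraph.fromRel_adj, M.symmetric t s, or_self] at h
  have h1 := M.off_diagonal s t hst
  push Not at h
  have := h hst
  omega

theorem coxeterGraph_restrictMatrix (M : CoxeterMatrix B) (Z : Set B) :
    coxeterGraph (restrictMatrix M Z) = (coxeterGraph M).induce Z := by
  ext s t
  simp [coxeterGraph, SimpleGraph.fromRel_adj, restrictMatrix, Subtype.ext_iff]

/-- The homomorphism from the Coxeter group of a full submatrix to the parabolic subgroup. -/
def restrictInclusion (Z : Set B) : (restrictMatrix M Z).Group →* W :=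
  (restrictMatrix M Z).toCoxeterSystem.lift
    ⟨fun s => cs.simple s, fun s t => cs.simple_mul_simple_pow s t⟩

theorem restrictInclusion_simple {Z : Set B} (s : Z) :
    restrictInclusion cs Z ((restrictMatrix M Z).toCoxeterSystem.simple s) = cs.simple s :=
  (restrictMatrix M Z).toCoxeterSystem.lift_apply_simple
    (fun s t => cs.simple_mul_simple_pow (s : B) t) s

theorem range_restrictInclusion (Z : Set B) :
    (restrictInclusion cs Z).range = standardParabolic cs Z := by
  rw [MonoidHom.range_eq_map, ← (restrictMatrix M Z).toCoxeterSystem.subgroup_closure_range_simple,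
    MonoidHom.map_closure, standardParabolic, ← Set.range_comp]
  congr 1
  rw [show restrictInclusion cs Z ∘ (restrictMatrix M Z).toCoxeterSystem.simple =
    cs.simple ∘ Subtype.val from funext (restrictInclusion_simple cs), Set.range_comp,
    Subtype.range_coe]

open Classical in
theorem isLiftable_restrictRetraction {Z : Set B} (hZ : ∀ s ∈ Z, ∀ t ∉ Z, M s t = 2) :
    M.IsLiftable fun s => if h : s ∈ Z then
      (restrictMatrix M Z).toCoxeterSystem.simple ⟨s, h⟩ else 1 := by
  intro s t
  by_cases hs : s ∈ Z <;> by_cases ht : t ∈ Z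
  · simp only [hs, ht, dif_pos]
    exact (restrictMatrix M Z).toCoxeterSystem.simple_mul_simple_pow ⟨s, hs⟩ ⟨t, ht⟩
  · simp only [hs, ht, dif_pos, dif_neg, not_false_eq_true, mul_one, hZ s hs t ht]
    exact (restrictMatrix M Z).toCoxeterSystem.simple_sq ⟨s, hs⟩
  · simp only [hs, ht, dif_pos, dif_neg, not_false_eq_true, one_mul, M.symmetric s t, hZ t ht s hs]
    exact (restrictMatrix M Z).toCoxeterSystem.simple_sq ⟨t, ht⟩
  · simp [hs, ht]

open Classical in
/-- The retraction of a Coxeter group onto a union of components, killing the other components. -/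
def restrictRetraction {Z : Set B} (hZ : ∀ s ∈ Z, ∀ t ∉ Z, M s t = 2) :
    W →* (restrictMatrix M Z).Group :=
  cs.lift ⟨_, isLiftable_restrictRetraction hZ⟩

theorem restrictRetraction_simple_of_mem {Z : Set B} (hZ : ∀ s ∈ Z, ∀ t ∉ Z, M s t = 2) {s : B}
    (hs : s ∈ Z) : restrictRetraction cs hZ (cs.simple s) =
      (restrictMatrix M Z).toCoxeterSystem.simple ⟨s, hs⟩ :=
  (cs.lift_apply_simple (isLiftable_restrictRetraction hZ) s).trans (dif_pos hs)

theorem restrictRetraction_simple_of_notMem {Z : Set B} (hZ : ∀ s ∈ Z, ∀ t ∉ Z, M s t = 2) {s : B}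
    (hs : s ∉ Z) : restrictRetraction cs hZ (cs.simple s) = 1 :=
  (cs.lift_apply_simple (isLiftable_restrictRetraction hZ) s).trans (dif_neg hs)

theorem restrictRetraction_restrictInclusion {Z : Set B} (hZ : ∀ s ∈ Z, ∀ t ∉ Z, M s t = 2)
    (g : (restrictMatrix M Z).Group) :
    restrictRetraction cs hZ (restrictInclusion cs Z g) = g := by
  have h : (restrictRetraction cs hZ).comp (restrictInclusion cs Z) = MonoidHom.id _ :=
    (restrictMatrix M Z).toCoxeterSystem.ext_simple fun s => by
      rw [MonoidHom.comp_apply, restrictInclusion_simple,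
        restrictRetraction_simple_of_mem cs hZ s.2, MonoidHom.id_apply]
  exact DFunLike.congr_fun h g

/-- The parabolic subgroup of a union of components is a Coxeter group. -/
theorem nonempty_coxeterSystem_standardParabolic {Z : Set B}
    (hZ : ∀ s ∈ Z, ∀ t ∉ Z, M s t = 2) :
    Nonempty (CoxeterSystem (restrictMatrix M Z) (standardParabolic cs Z)) :=
  ⟨(restrictMatrix M Z).toCoxeterSystem.map <|
    (MonoidHom.ofInjective (Function.LeftInverse.injective
      (restrictRetraction_restrictInclusion cs hZ))).trans
      (MulEquiv.subgroupCongr (range_restrictInclusion cs Z))⟩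

theorem exists_parabolic_retraction {Z : Set B} (hZ : ∀ s ∈ Z, ∀ t ∉ Z, M s t = 2) :
    ∃ p : W →* W, (∀ x ∈ standardParabolic cs Z, p x = x) ∧
      ∀ Y : Set B, Disjoint Y Z → ∀ x ∈ standardParabolic cs Y, p x = 1 := by
  refine ⟨(restrictInclusion cs Z).comp (restrictRetraction cs hZ), fun x hx => ?_,
    fun Y hY x hx => ?_⟩
  · rw [← range_restrictInclusion] at hx
    obtain ⟨g, rfl⟩ := hx
    rw [MonoidHom.comp_apply, restrictRetraction_restrictInclusion]
  · rw [MonoidHom.comp_apply, ← map_one (restrictInclusion cs Z)]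
    congr 1
    induction hx using Subgroup.closure_induction with
    | mem x hx =>
      obtain ⟨s, hs, rfl⟩ := hx
      exact restrictRetraction_simple_of_notMem cs hZ (Set.disjoint_left.1 hY hs)
    | one => exact map_one _
    | mul x y _ _ hx hy => rw [map_mul, hx, hy, one_mul]
    | inv x _ hx => rw [map_inv, hx, inv_one]

theorem simple_mem_standardParabolic {Z : Set B} {s : B} (hs : s ∈ Z) :
    cs.simple s ∈ standardParabolic cs Z :=
  Subgroup.subset_closure ⟨s, hs, rfl⟩

theorem commute_simple_of_mem_standardParabolic {Z : Set B} (hZ : ∀ s ∈ Z, ∀ t ∉ Z, M s t = 2)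
    {x : W} (hx : x ∈ standardParabolic cs Z) {t : B} (ht : t ∉ Z) : Commute (cs.simple t) x := by
  induction hx using Subgroup.closure_induction with
  | mem x hx =>
    obtain ⟨s, hs, rfl⟩ := hx
    have h := cs.simple_mul_simple_pow t s
    rw [M.symmetric, hZ s hs t ht, pow_two] at h
    have h1 := eq_inv_of_mul_eq_one_left h
    rwa [mul_inv_rev, cs.inv_simple, cs.inv_simple] at h1
  | one => exact Commute.one_right _
  | mul x y _ _ hx hy => exact hx.mul_right hy
  | inv x _ hx => exact hx.inv_right

theorem normal_of_simple_conj_mem {N : Subgroup W}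
    (h : ∀ s, ∀ x ∈ N, cs.simple s * x * (cs.simple s)⁻¹ ∈ N) : N.Normal := by
  refine ⟨fun x hx g => ?_⟩
  induction g using cs.simple_induction_left with
  | one => simpa using hx
  | mul_simple_left g s ih =>
    have := h s _ ih
    simpa [mul_assoc] using this

/-- A subgroup normalized by the parabolic subgroup of a union of components that contains it is
normal. -/
theorem normal_of_le_standardParabolic {Z : Set B} (hZ : ∀ s ∈ Z, ∀ t ∉ Z, M s t = 2)
    {N : Subgroup W} (hle : N ≤ standardParabolic cs Z)
    (hN : ∀ g ∈ standardParabolic cs Z, ∀ x ∈ N, g * x * g⁻¹ ∈ N) : N.Normal := by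
  refine normal_of_simple_conj_mem cs fun s x hx => ?_
  by_cases hs : s ∈ Z
  · exact hN _ (simple_mem_standardParabolic cs hs) x hx
  · rwa [(commute_simple_of_mem_standardParabolic cs hZ (hle hx) hs).eq, mul_inv_cancel_right]

theorem standardParabolic_normal {Z : Set B} (hZ : ∀ s ∈ Z, ∀ t ∉ Z, M s t = 2) :
    (standardParabolic cs Z).Normal :=
  normal_of_le_standardParabolic cs hZ le_rfl fun _ hg _ hx =>
    mul_mem (mul_mem hg hx) (inv_mem hg)

theorem supp_eq_two (c : (coxeterGraph M).ConnectedComponent) :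
    ∀ s ∈ c.supp, ∀ t ∉ c.supp, M s t = 2 := fun _ hs _ ht =>
  eq_two_of_not_adj (fun h => ht (h ▸ hs)) fun h =>
    ht ((SimpleGraph.ConnectedComponent.sound h.reachable).symm.trans hs)

theorem finite_finset_sup_of_normal {G ι : Type*} [Group G] (N : ι → Subgroup G) (t : Finset ι)
    (hnorm : ∀ i ∈ t, (N i).Normal) (hfin : ∀ i ∈ t, Finite (N i)) : Finite ↥(t.sup N) := by
  suffices h : (t.sup N).Normal ∧ ((t.sup N : Subgroup G) : Set G).Finite from h.2
  refine Finset.sup_induction (p := fun N : Subgroup G => N.Normal ∧ (N : Set G).Finite)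
    ⟨inferInstance, by simp⟩ ?_ fun i hi => ⟨hnorm i hi, hfin i hi⟩
  rintro P ⟨hP, hPf⟩ Q ⟨hQ, hQf⟩
  refine ⟨inferInstance, ?_⟩
  rw [Subgroup.mul_normal]
  exact hPf.mul hQf

theorem finite_standardParabolic [Finite B] {Z : Set B}
    (h : ∀ s ∈ Z, Finite (standardParabolic cs ((coxeterGraph M).connectedComponentMk s).supp)) :
    Finite (standardParabolic cs Z) := by
  classical
  have := Fintype.ofFinite B
  set t : Finset (coxeterGraph M).ConnectedComponent :=
    (Finset.univ.filter (· ∈ Z)).image (coxeterGraph M).connectedComponentMk with ht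
  have hfin := finite_finset_sup_of_normal (fun c => standardParabolic cs c.supp) t
    (fun c _ => standardParabolic_normal cs (supp_eq_two c)) fun c hc => by
      rw [ht, Finset.mem_image] at hc
      obtain ⟨s, hs, rfl⟩ := hc
      exact h s (Finset.mem_filter.1 hs).2
  refine Finite.of_injective _ (Subgroup.inclusion_injective (?_ : standardParabolic cs Z ≤
    t.sup fun c => standardParabolic cs c.supp))
  rw [standardParabolic, Subgroup.closure_le]
  rintro _ ⟨s, hs, rfl⟩
  have hmem : (coxeterGraph M).connectedComponentMk s ∈ t :=
    Finset.mem_image_of_mem _ (Finset.mem_filter.2 ⟨Finset.mem_univ s, hs⟩)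
  exact Finset.le_sup (f := fun c => standardParabolic cs c.supp) hmem
    (simple_mem_standardParabolic cs rfl)

section Component

variable (c : (coxeterGraph M).ConnectedComponent)

theorem connected_coxeterGraph_restrictMatrix :
    (coxeterGraph (restrictMatrix M c.supp)).Connected := by
  rw [coxeterGraph_restrictMatrix]
  exact c.connected_toSimpleGraph

variable [Finite B]

theorem isIndecomposableGroup_standardParabolic_supp (hc : Infinite (standardParabolic cs c.supp)) :
    IsIndecomposableGroup (standardParabolic cs c.supp) := by
  obtain ⟨cs'⟩ := nonempty_coxeterSystem_standardParabolic cs (supp_eq_two c)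
  have := Fintype.ofFinite c.supp
  exact isIndecomposableGroup_of_connected cs' (connected_coxeterGraph_restrictMatrix c)

theorem center_standardParabolic_supp (hc : Infinite (standardParabolic cs c.supp)) :
    Subgroup.center (standardParabolic cs c.supp) = ⊥ := by
  obtain ⟨cs'⟩ := nonempty_coxeterSystem_standardParabolic cs (supp_eq_two c)
  have := Fintype.ofFinite c.supp
  exact center_eq_bot_of_connected cs' (connected_coxeterGraph_restrictMatrix c)

end Component

theorem iSupIndep_of_hom {G ι : Type*} [Group G] {N : ι → Subgroup G}
    (h : ∀ i, ∃ (f : G →* G) (L : Subgroup G), (∀ x ∈ N i, f x = x) ∧ Disjoint (N i) L ∧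
      ∀ j, j ≠ i → ∀ x ∈ N j, f x ∈ L) : iSupIndep N := by
  intro i
  obtain ⟨f, L, hf, hdisj, hL⟩ := h i
  rw [Subgroup.disjoint_def] at hdisj ⊢
  intro x hx hx'
  refine hdisj hx ?_
  have hle : ⨆ j, ⨆ _ : j ≠ i, N j ≤ L.comap f := iSup₂_le fun j hj y hy => hL j hj y hy
  have := hle hx'
  rwa [Subgroup.mem_comap, hf x hx] at this

/-- The infinite irreducible components together with a Remak decomposition of the product of the
remaining components form a Remak decomposition. -/
theorem isRemakDecompositionOf_sumElim [Finite B] {ι κ : Type*}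
    {X : ι → (coxeterGraph M).ConnectedComponent} (hXinj : Function.Injective X)
    (hXall : ∀ c : (coxeterGraph M).ConnectedComponent,
      Infinite (standardParabolic cs c.supp) ↔ ∃ i, X i = c)
    {Z : Set B} (hZ : ∀ s, s ∈ Z ↔
      ¬ Infinite (standardParabolic cs ((coxeterGraph M).connectedComponentMk s).supp))
    {H : κ → Subgroup W} (hH : IsRemakDecompositionOf (standardParabolic cs Z) H) :
    IsRemakDecompositionOf (⊤ : Subgroup W)
      (Sum.elim (fun i => standardParabolic cs (X i).supp) H) := by
  obtain ⟨hHbot, hHle, hHnorm, hHind, hHsup, hHindec⟩ := hH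
  have hXinf : ∀ i, Infinite (standardParabolic cs (X i).supp) := fun i => (hXall _).2 ⟨i, rfl⟩
  have hZ2 : ∀ s ∈ Z, ∀ t ∉ Z, M s t = 2 := fun s hs t ht =>
    eq_two_of_not_adj (fun h => ht (h ▸ hs)) fun h => by
      rw [hZ] at hs ht
      rw [SimpleGraph.ConnectedComponent.sound h.reachable] at hs
      exact ht hs
  have hXZ : ∀ i, Disjoint (X i).supp Z := fun i => Set.disjoint_left.2 fun s hs hsZ => by
    rw [hZ, (hs : (coxeterGraph M).connectedComponentMk s = X i)] at hsZ
    exact hsZ (hXinf i)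
  have hXX : ∀ i j, j ≠ i → Disjoint (X j).supp (X i).supp := fun i j hji =>
    Set.disjoint_left.2 fun s hs hs' => hji (hXinj (hs.symm.trans hs'))
  refine ⟨?_, fun _ => le_top, ?_, ?_, ?_, ?_⟩
  · rintro (i | j)
    · intro h
      have := hXinf i
      rw [Sum.elim_inl] at h
      rw [h] at this
      exact not_finite (⊥ : Subgroup W)
    · exact hHbot j
  · rintro (i | j) g - x hx
    · exact (standardParabolic_normal cs (supp_eq_two (X i))).conj_mem x hx g
    · exact (normal_of_le_standardParabolic cs hZ2 (hHle j) (hHnorm j)).conj_mem x hx g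
  · refine iSupIndep_of_hom ?_
    rintro (i | j)
    · obtain ⟨p, hp, hp'⟩ := exists_parabolic_retraction cs (supp_eq_two (X i))
      refine ⟨p, ⊥, hp, disjoint_bot_right, ?_⟩
      rintro (i' | j') hne x hx
      · exact hp' _ (hXX i i' fun h => hne (h ▸ rfl)) x hx
      · exact hp' _ (hXZ i).symm x (hHle j' hx)
    · obtain ⟨p, hp, hp'⟩ := exists_parabolic_retraction cs hZ2
      refine ⟨p, _, fun x hx => hp x (hHle j hx), hHind j, ?_⟩
      rintro (i' | j') hne x hx
      · rw [hp' _ (hXZ i') x hx]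
        exact one_mem _
      · rw [hp x (hHle j' hx)]
        exact le_iSup₂ (f := fun k (_ : k ≠ j) => H k) j' (fun h => hne (h ▸ rfl)) hx
  · refine eq_top_of_simple_mem cs fun s => ?_
    rw [iSup_sum]
    by_cases hs : s ∈ Z
    · refine Subgroup.mem_sup_right ?_
      simp only [Sum.elim_inr, hHsup]
      exact simple_mem_standardParabolic cs hs
    · rw [hZ, not_not, hXall] at hs
      obtain ⟨i, hi⟩ := hs
      refine Subgroup.mem_sup_left ?_
      exact le_iSup (fun i => standardParabolic cs (X i).supp) i
        (simple_mem_standardParabolic cs hi.symm)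
  · rintro (i | j)
    · exact isIndecomposableGroup_standardParabolic_supp cs (X i) (hXinf i)
    · exact hHindec j

end Parabolic

/-- **Theorem 5.2.** With `X 1, …, X b` the connected components of the Coxeter
graph with infinite parabolic `W_{X i}`, `Z₃` the union of the remaining (spherical) components
and `W_{Z₃} = H 1 × ⋯ × H q` a Remak decomposition of the finite part, the family
`W_{X 1}, …, W_{X b}, H 1, …, H q` is a Remak decomposition of `W`; moreover any Remak
decomposition `W = G 1 × ⋯ × G m` satisfies `m = b + q` and is obtained from the previous one
by a central automorphism and a permutation of the factors. -/
theorem remak_decomposition_unique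
    [Fintype B] {M : CoxeterMatrix B} (cs : CoxeterSystem M W)
    (b q : ℕ)
    (X : Fin b → (coxeterGraph M).ConnectedComponent)
    (hXinj : Function.Injective X)
    (hXall : ∀ c : (coxeterGraph M).ConnectedComponent,
      Infinite (standardParabolic cs c.supp) ↔ ∃ i, X i = c)
    (Z₃ : Set B)
    (hZ₃ : Z₃ = {s : B |
      ¬ Infinite (standardParabolic cs ((coxeterGraph M).connectedComponentMk s).supp)})
    (H : Fin q → Subgroup W)
    (hH : IsRemakDecompositionOf (standardParabolic cs Z₃) H) :
    IsRemakDecompositionOf (⊤ : Subgroup W)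
      (Sum.elim (fun i => standardParabolic cs (X i).supp) H) ∧
    ∀ (m : ℕ) (G : Fin m → Subgroup W), IsRemakDecompositionOf (⊤ : Subgroup W) G →
      m = b + q ∧
      ∃ (σ : Fin b ⊕ Fin q ≃ Fin m) (φ : W ≃* W), IsCentralAut φ ∧
        (∀ i : Fin b, (standardParabolic cs (X i).supp).map φ.toMonoidHom = G (σ (Sum.inl i))) ∧
        (∀ j : Fin q, (H j).map φ.toMonoidHom = G (σ (Sum.inr j))) := by
  have hZ : ∀ s, s ∈ Z₃ ↔
      ¬ Infinite (standardParabolic cs ((coxeterGraph M).connectedComponentMk s).supp) := fun s => by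
    subst hZ₃; exact Iff.rfl
  have hN := isRemakDecompositionOf_sumElim cs hXinj hXall hZ hH
  refine ⟨hN, fun m G hG => ?_⟩
  have hfinZ : Finite (standardParabolic cs Z₃) :=
    finite_standardParabolic cs fun s hs => not_infinite_iff_finite.1 ((hZ s).1 hs)
  have hcenter : Finite (Subgroup.center W) := by
    refine finite_center_of_iSupIndep hN.normal hN.2.2.2.1 hN.2.2.2.2.1 ?_
    rintro (i | j)
    · rw [Sum.elim_inl, center_standardParabolic_supp cs (X i) ((hXall _).2 ⟨i, rfl⟩)]
      infer_instance
    · have : Finite (H j) := Finite.of_injective _ (Subgroup.inclusion_injective (hH.2.1 j))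
      exact inferInstanceAs (Finite (Subgroup.center (H j)))
  obtain ⟨σ, φ, hφ, hσ⟩ := hN.exists_equiv_centralAut hG
  refine ⟨?_, σ, φ, hφ, fun i => hσ (Sum.inl i), fun j => hσ (Sum.inr j)⟩
  have := Fintype.card_congr σ
  rw [Fintype.card_sum, Fintype.card_fin, Fintype.card_fin, Fintype.card_fin] at this
  exact this.symm

end CoxeterPaper
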